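/- arXiv:1607.00054 — 2 statements merged into one kernel-verified Lean document; each statement's English description precedes it below -/
import Mathlib

section
/- Let G be a countable group, c a circular order on G, and ρ a dynamical realization of c with basepoint x₀ ∈ S¹. For every finite set F ⊆ G and every ε > 0 there exists a finite set S ⊆ G such that every circular order c' on G with c'(u,v,w) = c(u,v,w) for all u,v,w ∈ S admits a dynamical realization ρ' with basepoint x₀ satisfying d(ρ'(g)x, ρ(g)x) < ε for all g ∈ F and all x ∈ S¹. -/
noncomputable section

open Classical in
/-- The circle `ℝ/ℤ`. -/
abbrev S1 : Type := AddCircle (1 : ℝ)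

/-- The canonical representative of a point of the circle in `[0,1)`. -/
noncomputable def S1.rep (x : S1) : ℝ := (AddCircle.equivIco 1 0 x : ℝ)

open Classical in
/-- The orientation cocycle on the circle: `1` on positively oriented (counterclockwise)
triples of pairwise distinct points, `-1` on negatively oriented ones, `0` otherwise. -/
noncomputable def circOrd (x y z : S1) : ℤ :=
  if x = y ∨ y = z ∨ x = z then 0
  else if (S1.rep x < S1.rep y ∧ S1.rep y < S1.rep z) ∨
      (S1.rep y < S1.rep z ∧ S1.rep z < S1.rep x) ∨
      (S1.rep z < S1.rep x ∧ S1.rep x < S1.rep y) then 1 else -1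

/-- The group `Homeo₊(S¹)` of orientation preserving homeomorphisms of the circle, realized
as the subgroup of bijections of `S¹` which are homeomorphisms and preserve the orientation
cocycle. -/
noncomputable def HomeoPos : Subgroup (Equiv.Perm S1) where
  carrier := {f | Continuous f ∧ Continuous f.symm ∧
    ∀ x y z, circOrd (f x) (f y) (f z) = circOrd x y z}
  one_mem' := ⟨by simpa using continuous_id, by exact continuous_id, by simp⟩
  mul_mem' := by
    rintro a b ⟨ha1, ha2, ha3⟩ ⟨hb1, hb2, hb3⟩
    refine ⟨?_, ?_, ?_⟩
    · have : ⇑(a * b) = ⇑a ∘ ⇑b := by ext x; simp [Equiv.Perm.mul_apply]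
      rw [this]; exact ha1.comp hb1
    · have : ⇑(a * b).symm = ⇑b.symm ∘ ⇑a.symm := by
        ext x; rfl
      rw [this]; exact hb2.comp ha2
    · intro x y z
      simp only [Equiv.Perm.mul_apply]
      rw [ha3, hb3]
  inv_mem' := by
    rintro a ⟨ha1, ha2, ha3⟩
    refine ⟨ha2, by exact ha1, ?_⟩
    intro x y z
    have := ha3 (a⁻¹ x) (a⁻¹ y) (a⁻¹ z)
    simpa using this.symm

/-- The action of an element of `Homeo₊(S¹)` on the circle. -/
def ap (h : ↥HomeoPos) (x : S1) : S1 := h.1 x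

lemma ap_one (x : S1) : ap 1 x = x := rfl

lemma ap_mul (h₁ h₂ : ↥HomeoPos) (x : S1) : ap (h₁ * h₂) x = ap h₁ (ap h₂ x) := rfl

variable {G : Type*} [Group G]

/-- A (left-invariant) circular order on a group `G`: a function `G³ → {-1,0,1}` vanishing
exactly on degenerate triples, satisfying the cocycle identity, and left-invariant. -/
def IsCircularOrder (c : G → G → G → ℤ) : Prop :=
  (∀ a b d, c a b d = 0 ↔ a = b ∨ b = d ∨ a = d) ∧
  (∀ a b d, c a b d = 1 ∨ c a b d = 0 ∨ c a b d = -1) ∧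
  (∀ g₁ g₂ g₃ g₄, c g₂ g₃ g₄ - c g₁ g₃ g₄ + c g₁ g₂ g₄ - c g₁ g₂ g₃ = 0) ∧
  (∀ g u v w, c (g * u) (g * v) (g * w) = c u v w)

/-- `c` is an isolated point of the space `CO(G)` of circular orders on `G` (with the
topology induced from the product topology on `{-1,0,1}^{G³}`): some basic neighborhood,
determined by agreement on a finite subset of `G`, contains only `c`. -/
def IsIsolatedCO (c : G → G → G → ℤ) : Prop :=
  ∃ S : Finset G, ∀ c' : G → G → G → ℤ, IsCircularOrder c' →
    (∀ u ∈ S, ∀ v ∈ S, ∀ w ∈ S, c' u v w = c u v w) → c' = c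

/-- The basepoint `x₀` has trivial stabilizer under the action `ρ`. -/
def TrivialStabilizer (ρ : G →* ↥HomeoPos) (x₀ : S1) : Prop :=
  ∀ g : G, ap (ρ g) x₀ = x₀ → g = 1

/-- The circular order on `G` induced by the orbit of a point `x₀` with trivial stabilizer. -/
def inducedCO (ρ : G →* ↥HomeoPos) (x₀ : S1) (g₁ g₂ g₃ : G) : ℤ :=
  circOrd (ap (ρ g₁) x₀) (ap (ρ g₂) x₀) (ap (ρ g₃) x₀)

/-- A continuous degree-one monotone map of the circle: a continuous surjection which
weakly preserves the orientation cocycle. -/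
def DegOneMonotone (f : S1 → S1) : Prop :=
  Continuous f ∧ Function.Surjective f ∧
    ∀ x y z, f x ≠ f y → f y ≠ f z → f x ≠ f z → circOrd (f x) (f y) (f z) = circOrd x y z

/-- `ρ` is a dynamical realization of the circular order `c` with basepoint `x₀`. -/
def IsDynamicalRealization (ρ : G →* ↥HomeoPos) (x₀ : S1) (c : G → G → G → ℤ) : Prop :=
  TrivialStabilizer ρ x₀ ∧
  (∀ g₁ g₂ g₃, inducedCO ρ x₀ g₁ g₂ g₃ = c g₁ g₂ g₃) ∧
  ∀ ρ' : G →* ↥HomeoPos, TrivialStabilizer ρ' x₀ →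
    (∀ g₁ g₂ g₃, inducedCO ρ' x₀ g₁ g₂ g₃ = c g₁ g₂ g₃) →
    ∃ f : S1 → S1, DegOneMonotone f ∧ f x₀ = x₀ ∧
      ∀ g : G, (ap (ρ g)) ∘ f = f ∘ (ap (ρ' g))

end
noncomputable section

open Classical in
/-- cyclic cocycle of a linear order -/
def cyc {α : Type*} [LinearOrder α] (x y z : α) : ℤ :=
  if x = y ∨ y = z ∨ x = z then 0
  else if (x < y ∧ y < z) ∨ (y < z ∧ z < x) ∨ (z < x ∧ x < y) then 1 else -1

lemma cyc_map {α β : Type*} [LinearOrder α] [LinearOrder β] (f : α → β) (hf : StrictMono f)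
    (x y z : α) : cyc (f x) (f y) (f z) = cyc x y z := by
  simp only [cyc, hf.lt_iff_lt, hf.injective.eq_iff]

lemma cyc_one_iff {α : Type*} [LinearOrder α] (x y z : α) :
    cyc x y z = 1 ↔ (x < y ∧ y < z) ∨ (y < z ∧ z < x) ∨ (z < x ∧ x < y) := by
  unfold cyc
  split_ifs with h1 h2
  · constructor
    · intro h; simp at h
    · intro h
      exfalso
      rcases h1 with rfl | rfl | rfl
      · rcases h with h | h | h
        · exact lt_irrefl _ h.1
        · exact lt_asymm h.1 h.2
        · exact lt_irrefl _ h.2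
      · rcases h with h | h | h
        · exact lt_irrefl _ h.2
        · exact lt_irrefl _ h.1
        · exact lt_asymm h.1 h.2
      · rcases h with h | h | h
        · exact lt_asymm h.1 h.2
        · exact lt_irrefl _ h.2
        · exact lt_irrefl _ h.1
  · simp [h2]
  · simp [h2]

lemma cyc_zero_iff {α : Type*} [LinearOrder α] (x y z : α) :
    cyc x y z = 0 ↔ x = y ∨ y = z ∨ x = z := by
  unfold cyc
  split_ifs with h1 h2 <;> simp [h1]

lemma cyc_vals {α : Type*} [LinearOrder α] (x y z : α) :
    cyc x y z = 1 ∨ cyc x y z = 0 ∨ cyc x y z = -1 := by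
  unfold cyc
  split_ifs with h1 h2 <;> simp

/-- two values in `{1,0,-1}` agree as soon as being `1` and being `0` agree -/
lemma val_eq {a b : ℤ} (ha : a = 1 ∨ a = 0 ∨ a = -1) (hb : b = 1 ∨ b = 0 ∨ b = -1)
    (h1 : a = 1 ↔ b = 1) (h0 : a = 0 ↔ b = 0) : a = b := by
  omega

lemma rep_nonneg (x : S1) : 0 ≤ S1.rep x := (AddCircle.equivIco 1 0 x).2.1
lemma rep_lt (x : S1) : S1.rep x < 1 := by
  have := (AddCircle.equivIco (1:ℝ) 0 x).2.2
  simpa [S1.rep] using this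
lemma coe_rep (x : S1) : ((S1.rep x : ℝ) : S1) = x := AddCircle.coe_equivIco
lemma rep_inj {x y : S1} : S1.rep x = S1.rep y ↔ x = y :=
  ⟨fun h => by rw [← coe_rep x, ← coe_rep y, h], fun h => by rw [h]⟩
lemma rep_coe (t : ℝ) : S1.rep (t : S1) = Int.fract t := by
  unfold S1.rep
  rw [AddCircle.coe_equivIco_mk_apply]; simp
lemma rep_coe_of {t : ℝ} (h0 : 0 ≤ t) (h1 : t < 1) : S1.rep (t : S1) = t := by
  rw [rep_coe, Int.fract_eq_self.2 ⟨h0, h1⟩]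

lemma circOrd_rep (x y z : S1) : circOrd x y z = cyc (S1.rep x) (S1.rep y) (S1.rep z) := by
  simp only [circOrd, cyc, rep_inj]

/-- coordinate cut at `p` -/
def cu (p x : S1) : ℝ := S1.rep (x - p)

lemma cu_nonneg (p x : S1) : 0 ≤ cu p x := rep_nonneg _
lemma cu_lt (p x : S1) : cu p x < 1 := rep_lt _
lemma add_cu (p x : S1) : p + ((cu p x : ℝ) : S1) = x := by
  rw [cu, coe_rep]; abel
lemma cu_inj {p x y : S1} : cu p x = cu p y ↔ x = y := by
  rw [cu, cu, rep_inj]; simp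
lemma cu_add {p : S1} {t : ℝ} (h0 : 0 ≤ t) (h1 : t < 1) : cu p (p + (t : S1)) = t := by
  rw [cu, add_sub_cancel_left, rep_coe_of h0 h1]
lemma cu_self (p : S1) : cu p p = 0 := by
  have := cu_add (p := p) (t := 0) le_rfl one_pos
  simpa using this
lemma cu_eq_zero {p x : S1} : cu p x = 0 ↔ x = p := by
  rw [← cu_self p, cu_inj]
lemma cu_pos {p x : S1} : 0 < cu p x ↔ x ≠ p := by
  rw [← not_iff_not, not_lt, not_not, ← cu_eq_zero (p := p)]
  exact ⟨fun h => le_antisymm h (cu_nonneg _ _), fun h => h.le⟩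

lemma cu_rep (p x : S1) :
    (S1.rep p ≤ S1.rep x ∧ cu p x = S1.rep x - S1.rep p) ∨
    (S1.rep x < S1.rep p ∧ cu p x = S1.rep x - S1.rep p + 1) := by
  have hx := rep_nonneg x
  have hx' := rep_lt x
  have hp := rep_nonneg p
  have hp' := rep_lt p
  rcases le_or_gt (S1.rep p) (S1.rep x) with h | h
  · left; refine ⟨h, ?_⟩
    rw [← cu_add (p := p) (t := S1.rep x - S1.rep p) (by linarith) (by linarith)]
    congr 1
    rw [AddCircle.coe_sub, coe_rep, coe_rep]; abel
  · right; refine ⟨h, ?_⟩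
    rw [← cu_add (p := p) (t := S1.rep x - S1.rep p + 1) (by linarith) (by linarith)]
    congr 1
    rw [AddCircle.coe_add, AddCircle.coe_sub, coe_rep, coe_rep]
    have : ((1 : ℝ) : S1) = 0 := AddCircle.coe_period 1
    rw [this]; abel

lemma circOrd_cu (p x y z : S1) : circOrd x y z = cyc (cu p x) (cu p y) (cu p z) := by
  rw [circOrd_rep]
  apply val_eq (cyc_vals _ _ _) (cyc_vals _ _ _)
  · rw [cyc_one_iff, cyc_one_iff]
    have hx := rep_nonneg x
    have hx' := rep_lt x
    have hy := rep_nonneg y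
    have hy' := rep_lt y
    have hz := rep_nonneg z
    have hz' := rep_lt z
    rcases cu_rep p x with ⟨h1, e1⟩ | ⟨h1, e1⟩ <;> rcases cu_rep p y with ⟨h2, e2⟩ | ⟨h2, e2⟩ <;>
    rcases cu_rep p z with ⟨h3, e3⟩ | ⟨h3, e3⟩ <;> rw [e1, e2, e3] <;> grind
  · rw [cyc_zero_iff, cyc_zero_iff]
    simp only [rep_inj, cu_inj]

lemma circOrd_vals (x y z : S1) : circOrd x y z = 1 ∨ circOrd x y z = 0 ∨ circOrd x y z = -1 := by
  rw [circOrd_rep]; exact cyc_vals _ _ _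

lemma circOrd_zero_iff (x y z : S1) : circOrd x y z = 0 ↔ x = y ∨ y = z ∨ x = z := by
  rw [circOrd_rep, cyc_zero_iff]; simp only [rep_inj]

lemma circOrd_base (p x y : S1) : circOrd p x y = 1 ↔ 0 < cu p x ∧ cu p x < cu p y := by
  rw [circOrd_cu p, cyc_one_iff, cu_self]
  have hx := cu_nonneg p x
  have hy := cu_nonneg p y
  grind

lemma cu_lt_iff (p x y : S1) : cu p x < cu p y ↔ circOrd p x y = 1 ∨ (x = p ∧ y ≠ p) := by
  rw [circOrd_base, ← cu_pos (p := p), ← cu_eq_zero (p := p)]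
  have hx := cu_nonneg p x
  grind

lemma norm_coe_le (t : ℝ) : ‖(t : S1)‖ ≤ |t| := QuotientAddGroup.norm_mk_le_norm

lemma exists_lift_norm (x : S1) : ∃ t : ℝ, (t : S1) = x ∧ |t| = ‖x‖ := by
  refine ⟨S1.rep x - round (S1.rep x), ?_, ?_⟩
  · rw [AddCircle.coe_sub, coe_rep]
    have : (((round (S1.rep x) : ℤ) : ℝ) : S1) = 0 := by
      rw [AddCircle.coe_eq_zero_iff]
      exact ⟨round (S1.rep x), by simp⟩
    rw [this, sub_zero]
  · rw [← UnitAddCircle.norm_eq, coe_rep]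

/-- arcs are open -/
lemma arc_open (p : S1) (a b : ℝ) : IsOpen ((fun t : ℝ => p + (t : S1)) '' Set.Ioo a b) := by
  have h : IsOpen ((fun t : ℝ => (t : S1)) '' Set.Ioo a b) :=
    QuotientAddGroup.isOpenMap_coe _ isOpen_Ioo
  have := (Homeomorph.addLeft p).isOpenMap _ h
  rw [Set.image_image] at this
  exact this

lemma dense_arc {X : Type*} {d : X → S1} (hd : DenseRange d) (p : S1) {a b : ℝ} (ha : 0 ≤ a)
    (hab : a < b) (hb : b ≤ 1) : ∃ x, a < cu p (d x) ∧ cu p (d x) < b := by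
  obtain ⟨x, t, ht, hx⟩ := hd.exists_mem_open (arc_open p a b)
    ((Set.nonempty_Ioo.2 hab).image _)
  refine ⟨x, ?_⟩
  simp only at hx
  rw [← hx, cu_add (by linarith [ht.1]) (by linarith [ht.2])]
  exact ht

lemma uniq {X : Type*} {a : X → S1} {f₁ f₂ : S1 → S1} (h₁ : DegOneMonotone f₁)
    (h₂ : DegOneMonotone f₂) (h : ∀ x, f₁ (a x) = f₂ (a x)) (hd : DenseRange (f₁ ∘ a)) :
    f₁ = f₂ := by
  funext x
  by_contra hne
  have hr : 0 < cu (f₁ x) (f₂ x) := cu_pos.2 (Ne.symm hne)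
  obtain ⟨i, hi0, hi1⟩ := dense_arc hd (f₁ x) le_rfl hr (cu_lt _ _).le
  obtain ⟨j, hj0, hj1⟩ := dense_arc hd (f₁ x) hr.le (cu_lt _ _) le_rfl
  simp only [Function.comp] at hi0 hi1 hj0 hj1
  have e1 : circOrd (f₁ x) (f₁ (a i)) (f₁ (a j)) = 1 := by
    rw [circOrd_base]; exact ⟨hi0, hi1.trans hj0⟩
  have e2 : circOrd (f₂ x) (f₁ (a i)) (f₁ (a j)) ≠ 1 := by
    rw [circOrd_cu (f₁ x), Ne, cyc_one_iff]
    grind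
  have n1 : f₁ x ≠ f₁ (a i) := fun h => by rw [← h, cu_self] at hi0; exact lt_irrefl _ hi0
  have n2 : f₁ (a i) ≠ f₁ (a j) := fun h => by
    rw [h] at hi1; exact lt_asymm hi1 hj0
  have n3 : f₁ x ≠ f₁ (a j) := fun h => by
    rw [← h, cu_self] at hj0; exact lt_asymm hr hj0
  have n4 : f₂ x ≠ f₂ (a i) := fun h' => by
    rw [h i, ← h'] at hi1; exact lt_irrefl _ hi1
  have n5 : f₂ x ≠ f₂ (a j) := fun h' => by
    rw [h j, ← h'] at hj0; exact lt_irrefl _ hj0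
  have n6 : f₂ (a i) ≠ f₂ (a j) := by rw [← h, ← h]; exact n2
  rw [h₁.2.2 _ _ _ n1 n2 n3] at e1
  rw [h i, h j, h₂.2.2 _ _ _ n4 n6 n5] at e2
  exact e2 e1

end

noncomputable section

lemma mono_real {X : Type*} (A B : X → ℝ) (e : X) (hA : ∀ x, 0 ≤ A x ∧ A x < 1)
    (hB : ∀ x, 0 ≤ B x ∧ B x < 1) (hAe : A e = 0) (hBe : B e = 0)
    (hlt : ∀ x y, A x < A y ↔ B x < B y)
    (hd : ∀ a b : ℝ, 0 ≤ a → a < b → b ≤ 1 → ∃ x, a < B x ∧ B x < b) :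
    ∃ F : ℝ → ℝ, Continuous F ∧ Monotone F ∧ F 0 = 0 ∧ F 1 = 1 ∧ ∀ x, F (A x) = B x := by
  classical
  let S : ℝ → Set ℝ := fun t => {b | ∃ x, A x ≤ t ∧ B x = b}
  have hbdd : ∀ t, BddAbove (S t) := fun t => ⟨1, by rintro _ ⟨x, _, rfl⟩; exact (hB x).2.le⟩
  have hne : ∀ t, 0 ≤ t → (0:ℝ) ∈ S t := fun t ht => ⟨e, by rw [hAe]; exact ht, hBe⟩
  let F : ℝ → ℝ := fun t => if t < 0 then t else if t < 1 then sSup (S t) else t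
  have hle : ∀ x y, A x ≤ A y → B x ≤ B y := fun x y h => by
    by_contra hc; exact absurd ((hlt y x).2 (not_le.1 hc)) (not_lt.2 h)
  have hF1 : ∀ t, 0 ≤ t → t < 1 → F t = sSup (S t) := fun t h0 h1 => by
    simp [F, not_lt.2 h0, h1]
  have hF0 : ∀ t, t < 0 → F t = t := fun t h0 => by simp [F, h0]
  have hF2 : ∀ t, 1 ≤ t → F t = t := fun t h0 => by
    simp only [F]
    rw [if_neg (by linarith), if_neg (by linarith)]
  have hb0 : ∀ t, 0 ≤ t → 0 ≤ sSup (S t) := fun t ht => le_csSup (hbdd t) (hne t ht)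
  have hb1 : ∀ t, 0 ≤ t → sSup (S t) ≤ 1 := fun t ht => csSup_le ⟨0, hne t ht⟩ (by
    rintro _ ⟨x, _, rfl⟩; exact (hB x).2.le)
  have hmono : Monotone F := by
    intro s t hst
    rcases lt_or_ge s 0 with h | h
    · rw [hF0 s h]
      rcases lt_or_ge t 0 with h' | h'
      · rw [hF0 t h']; exact hst
      · rcases lt_or_ge t 1 with h2 | h2
        · rw [hF1 t h' h2]; linarith [hb0 t h']
        · rw [hF2 t h2]; exact hst
    · rcases lt_or_ge s 1 with h1 | h1
      · rw [hF1 s h h1]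
        rcases lt_or_ge t 1 with h2 | h2
        · rw [hF1 t (h.trans hst) h2]
          apply csSup_le_csSup (hbdd t) ⟨0, hne s h⟩
          rintro _ ⟨x, hx, rfl⟩
          exact ⟨x, hx.trans hst, rfl⟩
        · rw [hF2 t h2]; exact (hb1 s h).trans h2
      · rw [hF2 s h1, hF2 t (h1.trans hst)]; exact hst
  have hFA : ∀ x, F (A x) = B x := by
    intro x
    rw [hF1 _ (hA x).1 (hA x).2]
    apply le_antisymm
    · apply csSup_le ⟨0, hne _ (hA x).1⟩
      rintro _ ⟨y, hy, rfl⟩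
      exact hle _ _ hy
    · exact le_csSup (hbdd _) ⟨x, le_rfl, rfl⟩
  refine ⟨F, ?_, hmono, ?_, hF2 1 le_rfl, hFA⟩
  · apply hmono.continuous_of_denseRange
    apply dense_of_exists_between
    intro a b hab
    rcases lt_or_ge a 0 with h | h
    · have h2 : a < min b 0 := lt_min hab h
      have h3 := min_le_left b 0
      have h4 := min_le_right b 0
      exact ⟨(a + min b 0)/2, ⟨_, hF0 _ (by linarith)⟩, by linarith, by linarith⟩
    · rcases lt_or_ge a 1 with h1 | h1
      · obtain ⟨x, hx1, hx2⟩ := hd a (min b 1) h (lt_min hab h1) (min_le_right _ _)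
        exact ⟨B x, ⟨A x, hFA x⟩, hx1, hx2.trans_le (min_le_left _ _)⟩
      · exact ⟨(a+b)/2, ⟨_, hF2 _ (by linarith)⟩, by linarith, by linarith⟩
  · have := hFA e
    rwa [hAe, hBe] at this

lemma mono_circ {X : Type*} (a b : X → S1) (e : X)
    (hlt : ∀ x y, cu (a e) (a x) < cu (a e) (a y) ↔ cu (b e) (b x) < cu (b e) (b y))
    (hd : DenseRange b) : ∃ f : S1 → S1, DegOneMonotone f ∧ ∀ x, f (a x) = b x := by
  obtain ⟨F, hc, hm, h0, h1, hF⟩ := mono_real (fun x => cu (a e) (a x)) (fun x => cu (b e) (b x)) e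
    (fun x => ⟨cu_nonneg _ _, cu_lt _ _⟩) (fun x => ⟨cu_nonneg _ _, cu_lt _ _⟩)
    (cu_self _) (cu_self _) hlt (fun s t h0 h1 h2 => dense_arc hd (b e) h0 h1 h2)
  have c1 : ((1 : ℝ) : S1) = 0 := AddCircle.coe_period 1
  let f0 : S1 → S1 := AddCircle.liftIco 1 0 (fun t => ((F t : ℝ) : S1))
  have hf0 : Continuous f0 := by
    apply AddCircle.liftIco_zero_continuous
    · rw [h0, h1, c1]; simp
    · exact ((AddCircle.continuous_mk' (1:ℝ)).comp hc).continuousOn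
  have hf0' : ∀ x, f0 x = ((F (S1.rep x) : ℝ) : S1) := by
    intro x
    conv_lhs => rw [← coe_rep x]
    exact AddCircle.liftIco_zero_coe_apply ⟨rep_nonneg _, rep_lt _⟩
  refine ⟨fun x => b e + f0 (x - a e), ⟨?_, ?_, ?_⟩, ?_⟩
  · exact continuous_const.add (hf0.comp (continuous_id.sub continuous_const))
  · intro y
    have hy0 := cu_nonneg (b e) y
    have hy1 := cu_lt (b e) y
    obtain ⟨t, ht, hty⟩ := intermediate_value_Icc zero_le_one hc.continuousOn
      (show cu (b e) y ∈ Set.Icc (F 0) (F 1) by rw [h0, h1]; exact ⟨hy0, hy1.le⟩)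
    have ht1 : t < 1 := lt_of_le_of_ne ht.2 (fun h => by rw [h, h1] at hty; linarith)
    refine ⟨a e + (t : S1), ?_⟩
    simp only [add_sub_cancel_left]
    rw [hf0', rep_coe_of ht.1 ht1, hty, add_cu]
  · intro x y z hxy hyz hxz
    simp only [hf0'] at *
    have key : ∀ w : S1, ∃ v, cu (b e) (b e + ((F (S1.rep (w - a e)) : ℝ) : S1)) = v ∧
       ((v = F (cu (a e) w) ∧ v < 1) ∨ (v = 0 ∧ F (cu (a e) w) = 1)) := by
      intro w
      have g0 : 0 ≤ F (cu (a e) w) := by rw [← h0]; exact hm (cu_nonneg _ _)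
      have g1 : F (cu (a e) w) ≤ 1 := by rw [← h1]; exact hm (cu_lt _ _).le
      refine ⟨_, rfl, ?_⟩
      rcases g1.lt_or_eq with h | h
      · left
        change cu (b e) (b e + ((F (cu (a e) w) : ℝ) : S1)) = _ ∧ _
        exact ⟨cu_add g0 h, cu_lt _ _⟩
      · right
        refine ⟨?_, h⟩
        change cu (b e) (b e + ((F (cu (a e) w) : ℝ) : S1)) = _
        rw [h, c1, add_zero, cu_self]
    have nXY : cu (a e) x ≠ cu (a e) y := fun h => hxy (by rw [cu_inj.1 h])
    have nYZ : cu (a e) y ≠ cu (a e) z := fun h => hyz (by rw [cu_inj.1 h])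
    have nXZ : cu (a e) x ≠ cu (a e) z := fun h => hxz (by rw [cu_inj.1 h])
    rw [Ne, ← cu_inj (p := b e)] at hxy hyz hxz
    rw [circOrd_cu (b e), circOrd_cu (a e) x y z]
    obtain ⟨vx, ex, kx⟩ := key x
    obtain ⟨vy, ey, ky⟩ := key y
    obtain ⟨vz, ez, kz⟩ := key z
    rw [ex, ey, ez]
    rw [ex, ey] at hxy
    rw [ey, ez] at hyz
    rw [ex, ez] at hxz
    have g0 : ∀ w, 0 ≤ F (cu (a e) w) := fun w => by rw [← h0]; exact hm (cu_nonneg _ _)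
    have gx := g0 x
    have gy := g0 y
    have gz := g0 z
    have mm : ∀ s t, F s < F t → s < t := fun s t h => by
      by_contra h'; exact absurd (hm (not_lt.1 h')) (not_le.2 h)
    have m1 := mm (cu (a e) x) (cu (a e) y)
    have m2 := mm (cu (a e) y) (cu (a e) x)
    have m3 := mm (cu (a e) x) (cu (a e) z)
    have m4 := mm (cu (a e) z) (cu (a e) x)
    have m5 := mm (cu (a e) z) (cu (a e) y)
    have m6 := mm (cu (a e) y) (cu (a e) z)
    generalize cu (a e) x = X at *
    generalize cu (a e) y = Y at *
    generalize cu (a e) z = Z at *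
    generalize F X = FX at *
    generalize F Y = FY at *
    generalize F Z = FZ at *
    clear mm g0 key ex ey ez
    apply val_eq (cyc_vals _ _ _) (cyc_vals _ _ _)
    · rw [cyc_one_iff, cyc_one_iff]
      clear h0 h1 hF c1 hf0 hf0' hc hm
      rcases kx with ⟨rfl, kx⟩ | ⟨rfl, rfl⟩ <;> rcases ky with ⟨rfl, ky⟩ | ⟨rfl, rfl⟩ <;>
        rcases kz with ⟨rfl, kz⟩ | ⟨rfl, rfl⟩ <;> grind
    · rw [cyc_zero_iff, cyc_zero_iff]
      simp [hxy, hyz, hxz, nXY, nYZ, nXZ]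
  · intro x
    simp only [hf0']
    change b e + ((F (cu (a e) (a x)) : ℝ) : S1) = b x
    rw [hF x, add_cu]

lemma PLfin {ι : Type*} (s : Finset ι) (A B : ι → ℝ)
    (h : ∀ i ∈ s, ∀ j ∈ s, A i < A j ↔ B i < B j) : ∃ e : ℝ ≃o ℝ, ∀ i ∈ s, e (A i) = B i := by
  classical
  induction s using Finset.induction_on_max_value A with
  | empty => exact ⟨OrderIso.refl _, by simp⟩
  | insert a s ha hmax ih =>
    obtain ⟨e, he⟩ := ih (fun i hi j hj => h i (Finset.mem_insert_of_mem hi) j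
      (Finset.mem_insert_of_mem hj))
    rcases s.eq_empty_or_nonempty with rfl | hs
    · refine ⟨OrderIso.addRight (B a - A a), ?_⟩
      simp
    · obtain ⟨m, hm, hmm⟩ := s.exists_max_image A hs
      have ham := h m (Finset.mem_insert_of_mem hm) a (Finset.mem_insert_self _ _)
      have hma := h a (Finset.mem_insert_self _ _) m (Finset.mem_insert_of_mem hm)
      rcases (hmax m hm).lt_or_eq with hlt | heq
      · have hB := ham.1 hlt
        have he1 : B m < e (A a) := by rw [← he m hm]; exact e.strictMono hlt
        have hl : 0 < (B a - B m) / (e (A a) - B m) := div_pos (by linarith) (by linarith)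
        set l := (B a - B m) / (e (A a) - B m) with hldef
        let χ : ℝ → ℝ → ℝ := fun l t => t + (l - 1) * max (t - B m) 0
        have χmono : ∀ l, 0 < l → StrictMono (χ l) := by
          intro l hl s t hst
          simp only [χ]
          rcases le_total (s - B m) 0 with h1 | h1 <;> rcases le_total (t - B m) 0 with h2 | h2
          · rw [max_eq_right h1, max_eq_right h2]; linarith
          · rw [max_eq_right h1, max_eq_left h2]
            rcases h2.lt_or_eq with h3 | h3
            · nlinarith [mul_pos hl h3]
            · rw [← h3]; linarith
          · linarith
          · rw [max_eq_left h1, max_eq_left h2]; nlinarith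
        have χinv : ∀ l, 0 < l → ∀ t, χ l (χ l⁻¹ t) = t := by
          intro l hl t
          have hli : 0 < l⁻¹ := inv_pos.2 hl
          have hll : l * l⁻¹ = 1 := mul_inv_cancel₀ hl.ne'
          simp only [χ]
          rcases le_total (t - B m) 0 with h2 | h2
          · rw [max_eq_right h2, mul_zero, add_zero, max_eq_right h2]; ring
          · rw [max_eq_left h2]
            have : t + (l⁻¹ - 1) * (t - B m) - B m = l⁻¹ * (t - B m) := by ring
            rw [this, max_eq_left (mul_nonneg hli.le h2)]
            linear_combination (t - B m) * hll
        let E : ℝ ≃o ℝ := StrictMono.orderIsoOfSurjective (χ l) (χmono l hl)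
          (fun t => ⟨χ l⁻¹ t, χinv l hl t⟩)
        refine ⟨e.trans E, ?_⟩
        intro i hi
        rw [OrderIso.trans_apply]
        change χ l (e (A i)) = B i
        rcases Finset.mem_insert.1 hi with rfl | hi
        · simp only [χ]
          rw [max_eq_left (by linarith), hldef]
          have : e (A i) - B m ≠ 0 := by linarith
          field_simp
          ring
        · rw [he i hi]
          have : B i ≤ B m := by
            rw [← he i hi, ← he m hm]; exact e.monotone (hmm i hi)
          simp only [χ]
          rw [max_eq_right (by linarith)]; ring
      · have hB : B a = B m := by
          apply le_antisymm
          · by_contra h'; have := ham.2 (not_le.1 h'); linarith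
          · by_contra h'; have := hma.2 (not_le.1 h'); linarith
        refine ⟨e, ?_⟩
        intro i hi
        rcases Finset.mem_insert.1 hi with rfl | hi
        · rw [← heq, he m hm, hB]
        · exact he i hi
end

noncomputable section

lemma ap_cont (h : ↥HomeoPos) : Continuous (ap h) := h.2.1
lemma ap_ord (h : ↥HomeoPos) (x y z : S1) :
    circOrd (ap h x) (ap h y) (ap h z) = circOrd x y z := h.2.2.2 x y z
lemma ap_inv_ap (h : ↥HomeoPos) (x : S1) : ap h⁻¹ (ap h x) = x := by
  rw [← ap_mul, inv_mul_cancel, ap_one]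
lemma ap_ap_inv (h : ↥HomeoPos) (x : S1) : ap h (ap h⁻¹ x) = x := by
  rw [← ap_mul, mul_inv_cancel, ap_one]
lemma ap_inj (h : ↥HomeoPos) {x y : S1} : ap h x = ap h y ↔ x = y := h.1.injective.eq_iff
lemma ap_surj (h : ↥HomeoPos) : Function.Surjective (ap h) := h.1.surjective

lemma ap_deg (h : ↥HomeoPos) : DegOneMonotone (ap h) :=
  ⟨ap_cont h, ap_surj h, fun x y z _ _ _ => ap_ord h x y z⟩

lemma DegOneMonotone.comp' {f g : S1 → S1} (hf : DegOneMonotone f) (hg : DegOneMonotone g) :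
    DegOneMonotone (f ∘ g) := by
  refine ⟨hf.1.comp hg.1, hf.2.1.comp hg.2.1, ?_⟩
  intro x y z h1 h2 h3
  simp only [Function.comp] at *
  rw [hf.2.2 _ _ _ h1 h2 h3]
  exact hg.2.2 _ _ _ (fun h => h1 (by rw [h])) (fun h => h2 (by rw [h])) (fun h => h3 (by rw [h]))

def mkHomeo (f g : S1 → S1) (hf : DegOneMonotone f) (hg : DegOneMonotone g)
    (hgf : ∀ x, g (f x) = x) (hfg : ∀ x, f (g x) = x) : ↥HomeoPos :=
  ⟨⟨f, g, hgf, hfg⟩, hf.1, hg.1, by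
    intro x y z
    have inj : Function.Injective f := Function.LeftInverse.injective hgf
    by_cases h : x = y ∨ y = z ∨ x = z
    · rw [(circOrd_zero_iff x y z).2 h, circOrd_zero_iff]
      simpa [inj.eq_iff] using h
    · push Not at h
      exact hf.2.2 x y z (inj.ne h.1) (inj.ne h.2.1) (inj.ne h.2.2)⟩

lemma ap_mkHomeo (f g : S1 → S1) (hf hg hgf hfg) (x : S1) :
    ap (mkHomeo f g hf hg hgf hfg) x = f x := rfl

lemma emb_real {X : Type*} [LinearOrder X] [Countable X] [DenselyOrdered X] [NoMaxOrder X]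
    (b : X) (hb : ∀ x, b ≤ x) : ∃ m : X → ℝ, StrictMono m ∧ m b = 0 ∧ (∀ x, m x < 1) ∧
      ∀ s t : ℝ, 0 ≤ s → s < t → t ≤ 1 → ∃ x, s < m x ∧ m x < t := by
  classical
  have : Nonempty (Set.Ioo (0:ℚ) 1) := ⟨⟨1/2, by norm_num, by norm_num⟩⟩
  obtain ⟨i⟩ := Order.iso_of_countable_dense (Set.Ioi b) (Set.Ioo (0:ℚ) 1)
  let m : X → ℝ := fun x => if h : b < x then ((i ⟨x, h⟩ : ℚ) : ℝ) else 0
  have m1 : ∀ x (h : b < x), m x = ((i ⟨x, h⟩ : ℚ) : ℝ) := fun x h => by simp [m, h]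
  have m0 : m b = 0 := by simp [m]
  have mpos : ∀ x, b < x → 0 < m x := fun x h => by
    rw [m1 x h]; exact_mod_cast (i ⟨x, h⟩).2.1
  refine ⟨m, ?_, m0, ?_, ?_⟩
  · intro x y hxy
    have hy : b < y := (hb x).trans_lt hxy
    rcases (hb x).lt_or_eq with h | h
    · rw [m1 x h, m1 y hy]
      have : i ⟨x, h⟩ < i ⟨y, hy⟩ := i.strictMono hxy
      exact_mod_cast this
    · rw [← h, m0]; exact mpos y hy
  · intro x
    rcases (hb x).lt_or_eq with h | h
    · rw [m1 x h]; exact_mod_cast (i ⟨x, h⟩).2.2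
    · rw [← h, m0]; exact one_pos
  · intro s t hs hst ht
    obtain ⟨q, hq1, hq2⟩ := exists_rat_btwn hst
    have hq0 : 0 < q := by exact_mod_cast hs.trans_lt hq1
    have hq3 : q < 1 := by exact_mod_cast hq2.trans_le ht
    obtain ⟨⟨x, hx⟩, hxq⟩ := i.surjective ⟨q, hq0, hq3⟩
    refine ⟨x, ?_⟩
    rw [m1 x hx, hxq]
    exact ⟨hq1, hq2⟩

lemma denseRange_of_arc {X : Type*} {d : X → S1} (p : S1)
    (h : ∀ s t : ℝ, 0 ≤ s → s < t → t ≤ 1 → ∃ x, s < cu p (d x) ∧ cu p (d x) < t) :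
    DenseRange d := by
  intro y
  rw [Metric.mem_closure_iff]
  intro ε hε
  have h0 := cu_nonneg p y
  have h1 := cu_lt p y
  obtain ⟨x, hx1, hx2⟩ := h (cu p y) (min 1 (cu p y + ε)) h0 (lt_min h1 (by linarith))
    (min_le_left _ _)
  refine ⟨d x, ⟨x, rfl⟩, ?_⟩
  have hx3 := hx2.trans_le (min_le_right _ _)
  have e : y - d x = ((cu p y - cu p (d x) : ℝ) : S1) := by
    conv_lhs => rw [← add_cu p y, ← add_cu p (d x)]
    rw [AddCircle.coe_sub]; abel
  rw [dist_eq_norm, e]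
  refine (norm_coe_le _).trans_lt ?_
  rw [abs_lt]; constructor <;> linarith

lemma realize {G X : Type*} [Group G] [LinearOrder X] [Countable X] [DenselyOrdered X]
    [NoMaxOrder X] (x₀ : S1) (b : X) (hb : ∀ x, b ≤ x) (act : G → X → X) (act1 : ∀ x, act 1 x = x)
    (actm : ∀ g h x, act (g * h) x = act g (act h x))
    (hinv : ∀ g x y z, cyc (act g x) (act g y) (act g z) = cyc x y z) :
    ∃ (ρ : G →* ↥HomeoPos) (ι : X → S1), (∀ g x, ap (ρ g) (ι x) = ι (act g x)) ∧ ι b = x₀ ∧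
      DenseRange ι ∧ (∀ x y z, circOrd (ι x) (ι y) (ι z) = cyc x y z) ∧ Function.Injective ι := by
  obtain ⟨m, hm, mb, mlt, md⟩ := emb_real b hb
  have mnn : ∀ x, 0 ≤ m x := fun x => by rw [← mb]; exact hm.monotone (hb x)
  let ι : X → S1 := fun x => x₀ + (m x : S1)
  have hι : ∀ x, cu x₀ (ι x) = m x := fun x => cu_add (mnn x) (mlt x)
  have hιd : DenseRange ι := by
    apply denseRange_of_arc x₀
    simpa only [hι] using md
  have hιo : ∀ x y z, circOrd (ι x) (ι y) (ι z) = cyc x y z := by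
    intro x y z
    rw [circOrd_cu x₀, hι, hι, hι, cyc_map m hm]
  have hιi : Function.Injective ι := by
    intro x y h
    apply hm.injective
    rw [← hι, ← hι, h]
  have acti : ∀ g, Function.Injective (act g) := by
    intro g x y h
    rw [← act1 x, ← act1 y, ← inv_mul_cancel g, actm, actm, h]
  have acts : ∀ g, Function.Surjective (act g) := by
    intro g x
    exact ⟨act g⁻¹ x, by rw [← actm, mul_inv_cancel, act1]⟩
  have H : ∀ g, ∃ f : S1 → S1, DegOneMonotone f ∧ ∀ x, f (ι x) = ι (act g x) := by
    intro g
    apply mono_circ ι (fun x => ι (act g x)) b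
    · intro x y
      rw [cu_lt_iff, cu_lt_iff, hιo, hιo, hinv]
      simp only [ne_eq, hιi.eq_iff, (acti g).eq_iff]
    · have : Set.range (fun x => ι (act g x)) = Set.range ι := (acts g).range_comp ι
      rw [DenseRange, this]; exact hιd
  choose f hf hfι using H
  have fcomp : ∀ g h x, f g (f h x) = f (g * h) x := by
    intro g h
    have : f g ∘ f h = f (g * h) := by
      apply hιd.equalizer ((hf g).1.comp (hf h).1) (hf _).1
      funext x
      simp only [Function.comp, hfι, actm]
    exact fun x => congrFun this x
  have f1 : ∀ x, f 1 x = x := by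
    have : f 1 = id := by
      apply hιd.equalizer (hf 1).1 continuous_id
      funext x
      simp only [Function.comp, hfι, act1, id]
    exact fun x => congrFun this x
  let ρ : G →* ↥HomeoPos :=
    { toFun := fun g => mkHomeo (f g) (f g⁻¹) (hf _) (hf _)
        (fun x => by rw [fcomp, inv_mul_cancel, f1]) (fun x => by rw [fcomp, mul_inv_cancel, f1])
      map_one' := by
        apply Subtype.ext; apply Equiv.ext; exact f1
      map_mul' := by
        intro g h
        apply Subtype.ext; apply Equiv.ext; intro x; exact (fcomp g h x).symm }
  refine ⟨ρ, ι, fun g x => hfι g x, ?_, hιd, hιo, hιi⟩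
  simp [ι, mb]

end

noncomputable section
section
variable {G : Type*} [Group G]

lemma co_rot {c : G → G → G → ℤ} (hc : IsCircularOrder c) (a b d : G) : c b d a = c a b d := by
  have h1 := hc.2.2.1 a b d a
  have h2 := (hc.1 a d a).2 (by simp)
  have h3 := (hc.1 a b a).2 (by simp)
  omega

lemma co_swap {c : G → G → G → ℤ} (hc : IsCircularOrder c) (a b d : G) : c a d b = - c a b d := by
  have h1 := hc.2.2.1 a b d b
  have h2 := (hc.1 b d b).2 (by simp)
  have h3 := (hc.1 a b b).2 (by simp)
  omega

lemma co_ne {c : G → G → G → ℤ} (hc : IsCircularOrder c) {a b d : G} (h : c a b d = 1) :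
    a ≠ b ∧ b ≠ d ∧ a ≠ d := by
  have : ¬ c a b d = 0 := by omega
  rw [hc.1] at this
  push Not at this
  exact this

lemma exists_cut {c : G → G → G → ℤ} (hc : IsCircularOrder c) :
    ∃ _L : LinearOrder G, (∀ a b : G, a < b ↔ (a = 1 ∧ b ≠ 1) ∨ c 1 a b = 1) := by
  classical
  let R : G → G → Prop := fun a b => (a = 1 ∧ b ≠ 1) ∨ c 1 a b = 1
  have irr : ∀ a, ¬ R a a := by
    rintro a (⟨h1, h2⟩ | h)
    · exact h2 h1
    · exact (co_ne hc h).2.1 rfl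
  have tr : ∀ a b d, R a b → R b d → R a d := by
    rintro a b d (⟨h1, h2⟩ | h) (⟨h3, h4⟩ | h')
    · exact absurd h3 h2
    · exact Or.inl ⟨h1, (co_ne hc h').2.2.symm⟩
    · exact absurd h3 (co_ne hc h).2.2.symm
    · right
      have := hc.2.2.1 1 a b d
      have v := hc.2.1 a b d
      have v' := hc.2.1 1 a d
      omega
  have tot : ∀ a b, a ≠ b → R a b ∨ R b a := by
    intro a b hab
    by_cases ha : a = 1
    · exact Or.inl (Or.inl ⟨ha, fun h => hab (ha.trans h.symm)⟩)
    by_cases hb : b = 1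
    · exact Or.inr (Or.inl ⟨hb, ha⟩)
    have h0 : ¬ c 1 a b = 0 := by
      rw [hc.1]; push Not; exact ⟨Ne.symm ha, hab, Ne.symm hb⟩
    have v := hc.2.1 1 a b
    have s := co_swap hc 1 a b
    have : c 1 a b = 1 ∨ c 1 b a = 1 := by omega
    exact this.imp Or.inr Or.inr
  have asym : ∀ a b, R a b → ¬ R b a := fun a b h h' => irr a (tr _ _ _ h h')
  refine ⟨{ le := fun a b => a = b ∨ R a b
            lt := R
            le_refl := fun a => Or.inl rfl
            le_trans := ?_
            lt_iff_le_not_ge := ?_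
            le_antisymm := ?_
            le_total := ?_
            toDecidableLE := Classical.decRel _ }, fun a b => Iff.rfl⟩
  · rintro a b d (rfl | h) (rfl | h')
    · exact Or.inl rfl
    · exact Or.inr h'
    · exact Or.inr h
    · exact Or.inr (tr _ _ _ h h')
  · intro a b
    constructor
    · intro h
      refine ⟨Or.inr h, ?_⟩
      rintro (rfl | h')
      · exact irr _ h
      · exact asym _ _ h h'
    · rintro ⟨rfl | h, h'⟩
      · exact absurd (Or.inl rfl) h'
      · exact h
  · rintro a b (rfl | h) (h' | h')
    · rfl
    · rfl
    · exact h'.symm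
    · exact absurd h' (asym _ _ h)
  · intro a b
    by_cases h : a = b
    · exact Or.inl (Or.inl h)
    · exact (tot a b h).imp Or.inr Or.inr

lemma cyc_cut {c : G → G → G → ℤ} (hc : IsCircularOrder c) [LinearOrder G]
    (hL : ∀ a b : G, a < b ↔ (a = 1 ∧ b ≠ 1) ∨ c 1 a b = 1) (a b d : G) :
    cyc a b d = c a b d := by
  have key : ∀ a b d : G, a < b → b < d → c a b d = 1 := by
    intro a b d h h'
    rw [hL] at h h'
    rcases h with ⟨h1, h2⟩ | h
    · rcases h' with ⟨h3, h4⟩ | h'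
      · exact absurd h3 h2
      · rw [h1]; exact h'
    · rcases h' with ⟨h3, h4⟩ | h'
      · exact absurd h3 (co_ne hc h).2.2.symm
      · have := hc.2.2.1 1 a b d
        have v := hc.2.1 a b d
        have v' := hc.2.1 1 a d
        omega
  apply val_eq (cyc_vals _ _ _) (hc.2.1 _ _ _)
  · rw [cyc_one_iff]
    constructor
    · rintro (h | h | h)
      · exact key _ _ _ h.1 h.2
      · rw [← co_rot hc]; exact key _ _ _ h.1 h.2
      · rw [← co_rot hc, ← co_rot hc]; exact key _ _ _ h.1 h.2
    · intro h
      have hne := co_ne hc h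
      by_contra hcon
      have s : c a d b = -1 := by rw [co_swap hc, h]
      have s' : c d b a = -1 := by rw [co_rot hc, s]
      have s'' : c b a d = -1 := by rw [co_rot hc, s']
      have k1 := key a d b
      have k2 := key d b a
      have k3 := key b a d
      rcases lt_or_gt_of_ne hne.1 with h1 | h1 <;> rcases lt_or_gt_of_ne hne.2.1 with h2 | h2 <;>
        rcases lt_or_gt_of_ne hne.2.2 with h3 | h3 <;> simp_all
  · rw [cyc_zero_iff, hc.1]

/-- discrete / dense alternative -/
def Good (c : G → G → G → ℤ) (s : G) (Q : Set ℝ) : Prop :=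
  (Q = {0} ∧ ∀ j, j ≠ 1 → ∃ g, c 1 g j = 1) ∨
  (Q = Set.Ico 0 1 ∧ s ≠ 1 ∧ ∀ j, j ≠ 1 → j = s ∨ c 1 s j = 1)

lemma exists_good {c : G → G → G → ℤ} (hc : IsCircularOrder c) : ∃ s Q, Good c s Q := by
  by_cases h : ∃ s, s ≠ 1 ∧ ∀ j, j ≠ 1 → j = s ∨ c 1 s j = 1
  · obtain ⟨s, hs⟩ := h
    exact ⟨s, _, Or.inr ⟨rfl, hs⟩⟩
  · refine ⟨1, _, Or.inl ⟨rfl, ?_⟩⟩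
    intro s hs
    push Not at h
    obtain ⟨j, h1, h2, h3⟩ := h s hs
    refine ⟨j, ?_⟩
    have v := hc.2.1 1 s j
    have z : ¬ c 1 s j = 0 := by
      rw [hc.1]; push Not; exact ⟨Ne.symm hs, h2.symm, Ne.symm h1⟩
    rw [co_swap hc]
    omega

/-- point of the orbit, or of a gap -/
def pt (ρ : G →* ↥HomeoPos) (x₀ : S1) (s : G) (g : G) (q : ℝ) : S1 :=
  ap (ρ g) (x₀ + ((q * cu x₀ (ap (ρ s) x₀) : ℝ) : S1))

lemma pt_zero (ρ : G →* ↥HomeoPos) (x₀ : S1) (s : G) (g : G) :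
    pt ρ x₀ s g 0 = ap (ρ g) x₀ := by simp [pt]

lemma pt_mul (ρ : G →* ↥HomeoPos) (x₀ : S1) (s : G) (g h : G) (q : ℝ) :
    ap (ρ g) (pt ρ x₀ s h q) = pt ρ x₀ s (g * h) q := by
  simp only [pt, map_mul, ap_mul]

lemma Good.zero_mem {c : G → G → G → ℤ} {s : G} {Q : Set ℝ} (h : Good c s Q) : (0:ℝ) ∈ Q := by
  rcases h with ⟨rfl, _⟩ | ⟨rfl, _⟩ <;> simp

lemma cyc_lex {α β : Type*} [LinearOrder α] [LinearOrder β] (x y z : α ×ₗ β) :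
    cyc x y z = 1 ↔ cyc (ofLex x).1 (ofLex y).1 (ofLex z).1 = 1 ∨
      ((ofLex x).1 = (ofLex y).1 ∧ (ofLex y).1 ≠ (ofLex z).1 ∧ (ofLex x).2 < (ofLex y).2) ∨
      ((ofLex y).1 = (ofLex z).1 ∧ (ofLex z).1 ≠ (ofLex x).1 ∧ (ofLex y).2 < (ofLex z).2) ∨
      ((ofLex z).1 = (ofLex x).1 ∧ (ofLex x).1 ≠ (ofLex y).1 ∧ (ofLex z).2 < (ofLex x).2) ∨
      ((ofLex x).1 = (ofLex y).1 ∧ (ofLex y).1 = (ofLex z).1 ∧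
        cyc (ofLex x).2 (ofLex y).2 (ofLex z).2 = 1) := by
  rw [cyc_one_iff, cyc_one_iff, cyc_one_iff]
  simp only [Prod.Lex.lt_iff]
  generalize (ofLex x).1 = x1
  generalize (ofLex x).2 = x2
  generalize (ofLex y).1 = y1
  generalize (ofLex y).2 = y2
  generalize (ofLex z).1 = z1
  generalize (ofLex z).2 = z2
  grind

lemma exists_tight [Countable G] [Nontrivial G] {c : G → G → G → ℤ} (hc : IsCircularOrder c)
    (x₀ : S1) {s : G} {Q : Set ℝ} (hg : Good c s Q) :
    ∃ ρ : G →* ↥HomeoPos, TrivialStabilizer ρ x₀ ∧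
      (∀ g₁ g₂ g₃, inducedCO ρ x₀ g₁ g₂ g₃ = c g₁ g₂ g₃) ∧
      DenseRange (fun z : G × Q => pt ρ x₀ s z.1 z.2) := by
  obtain ⟨L, hL⟩ := exists_cut hc
  have hcyc := cyc_cut hc hL
  have hbot : ∀ g : G, 1 ≤ g := by
    intro g
    by_cases h : g = 1
    · rw [h]
    · exact ((hL 1 g).2 (Or.inl ⟨rfl, h⟩)).le
  rcases id hg with ⟨hQ, hd⟩ | ⟨hQ, hs, hd⟩
  · have : DenselyOrdered G := ⟨by
      intro a b hab
      have hab1 : a⁻¹ * b ≠ 1 := fun h => hab.ne (inv_mul_eq_one.1 h)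
      obtain ⟨g, hg⟩ := hd _ hab1
      refine ⟨a * g, ?_⟩
      have h2 := hc.2.2.2 a 1 g (a⁻¹ * b)
      rw [mul_one, mul_inv_cancel_left, hg, ← hcyc, cyc_one_iff] at h2
      rcases h2 with h | h | h
      · exact h
      · exact absurd (h.2) (not_lt.2 hab.le)
      · exact absurd (h.1) (not_lt.2 hab.le)⟩
    have : NoMaxOrder G := ⟨by
      intro a
      by_cases ha : a = 1
      · obtain ⟨b, hb⟩ := exists_ne (1:G)
        exact ⟨b, by rw [ha, hL]; exact Or.inl ⟨rfl, hb⟩⟩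
      · obtain ⟨g, hg⟩ := hd a⁻¹ (inv_ne_one.2 ha)
        refine ⟨a * g, ?_⟩
        have h2 := hc.2.2.2 a 1 g a⁻¹
        rw [mul_one, mul_inv_cancel, hg] at h2
        rw [hL]; right
        rw [← co_rot hc]; exact h2⟩
    obtain ⟨ρ, ι, h1, h2, h3, h4, h5⟩ := realize (G := G) (X := G) x₀ 1 hbot (fun g h => g * h)
      one_mul mul_assoc (fun g x y z => by rw [hcyc, hcyc, hc.2.2.2])
    have h6 : ∀ g, ap (ρ g) x₀ = ι g := fun g => by rw [← h2, h1, mul_one]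
    refine ⟨ρ, ?_, ?_, ?_⟩
    · intro g hg
      apply h5; rw [← h6, hg, h2]
    · intro a b d
      rw [inducedCO, h6, h6, h6, h4, hcyc]
    · apply Dense.mono _ h3
      rintro _ ⟨g, rfl⟩
      exact ⟨(g, ⟨0, hg.zero_mem⟩), by simp only [pt_zero, h6]⟩
  · let X := G ×ₗ (Set.Ico (0:ℚ) 1)
    have mid : ∀ q : Set.Ico (0:ℚ) 1, ∃ q' : Set.Ico (0:ℚ) 1, q < q' := by
      rintro ⟨q, h0, h1⟩
      exact ⟨⟨(q+1)/2, by linarith, by linarith⟩, by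
        show q < (q+1)/2
        linarith⟩
    have : NoMaxOrder X := ⟨by
      intro x
      obtain ⟨q', hq'⟩ := mid (ofLex x).2
      exact ⟨toLex ((ofLex x).1, q'), by rw [Prod.Lex.lt_iff]; exact Or.inr ⟨rfl, hq'⟩⟩⟩
    have : DenselyOrdered X := ⟨by
      intro x y hxy
      rw [Prod.Lex.lt_iff] at hxy
      rcases hxy with h | ⟨h, h'⟩
      · obtain ⟨q', hq'⟩ := mid (ofLex x).2
        exact ⟨toLex ((ofLex x).1, q'), by rw [Prod.Lex.lt_iff]; exact Or.inr ⟨rfl, hq'⟩,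
          by rw [Prod.Lex.lt_iff]; exact Or.inl h⟩
      · obtain ⟨q', h1, h2⟩ := exists_between h'
        exact ⟨toLex ((ofLex x).1, q'), by rw [Prod.Lex.lt_iff]; exact Or.inr ⟨rfl, h1⟩,
          by rw [Prod.Lex.lt_iff]; exact Or.inr ⟨h, h2⟩⟩⟩
    have : Countable X := inferInstanceAs (Countable (G × (Set.Ico (0:ℚ) 1)))
    let z0 : Set.Ico (0:ℚ) 1 := ⟨0, le_rfl, one_pos⟩
    have hz0 : ∀ q, z0 ≤ q := fun q => q.2.1
    have xb : ∀ x : X, toLex ((1 : G), z0) ≤ x := by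
      intro x
      rw [Prod.Lex.le_iff]
      rcases (hbot (ofLex x).1).lt_or_eq with h | h
      · exact Or.inl h
      · exact Or.inr ⟨h, hz0 _⟩
    obtain ⟨ρ, ι, h1, h2, h3, h4, h5⟩ := realize (G := G) (X := X) x₀ (toLex (1, z0)) xb
      (fun g x => toLex (g * (ofLex x).1, (ofLex x).2))
      (fun x => by simp) (fun g h x => by simp [mul_assoc])
      (fun g x y z => by
        apply val_eq (cyc_vals _ _ _) (cyc_vals _ _ _)
        · rw [cyc_lex, cyc_lex]
          simp only [ofLex_toLex, hcyc, hc.2.2.2, mul_right_inj, ne_eq]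
        · rw [cyc_zero_iff, cyc_zero_iff]
          have : ∀ x y : X, toLex (g * (ofLex x).1, (ofLex x).2) =
              toLex (g * (ofLex y).1, (ofLex y).2) ↔ x = y := by
            intro x y
            simp only [toLex_inj, Prod.mk.injEq, mul_right_inj]
            exact Prod.ext_iff.symm
          rw [this, this, this])
    have h6 : ∀ g, ap (ρ g) x₀ = ι (toLex (g, z0)) := fun g => by
      rw [← h2, h1]; simp
    have h7 : ∀ g q, ι (toLex (g, q)) = ap (ρ g) (ι (toLex (1, q))) := fun g q => by
      rw [h1]; simp
    refine ⟨ρ, ?_, ?_, ?_⟩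
    · intro g hg
      rw [h6, ← h2] at hg
      have := h5 hg
      simpa using this
    · intro a b d
      rw [inducedCO, h6, h6, h6, h4, ← hcyc]
      apply val_eq (cyc_vals _ _ _) (cyc_vals _ _ _)
      · rw [cyc_lex]
        have : ¬ cyc z0 z0 z0 = 1 := by rw [cyc_one_iff]; simp
        simp [this]
      · rw [cyc_zero_iff, cyc_zero_iff]; simp
    · apply Dense.mono _ h3
      rintro _ ⟨x, rfl⟩
      obtain ⟨g, q⟩ := x
      change ι (toLex (g, q)) ∈ _
      rw [h7]
      have hr : 0 < cu x₀ (ap (ρ s) x₀) := by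
        rw [cu_pos, h6, ← h2]
        intro h
        have := h5 h
        simp at this
        exact hs this
      have hlt : cu x₀ (ι (toLex (1, q))) < cu x₀ (ap (ρ s) x₀) := by
        by_cases hq : q = z0
        · rw [hq, h2, cu_self]; exact hr
        · have hq' : z0 < q := lt_of_le_of_ne (hz0 q) (Ne.symm hq)
          have : circOrd x₀ (ι (toLex (1, q))) (ap (ρ s) x₀) = 1 := by
            rw [h6]
            conv_lhs => rw [← h2]
            rw [h4, cyc_lex]
            right; left
            simp [hq', Ne.symm hs]
          exact ((circOrd_base _ _ _).1 this).2
      refine ⟨(g, ⟨cu x₀ (ι (toLex (1, q))) / cu x₀ (ap (ρ s) x₀), ?_⟩), ?_⟩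
      · rw [hQ]
        exact ⟨div_nonneg (cu_nonneg _ _) hr.le, (div_lt_one hr).2 hlt⟩
      · simp only [pt]
        rw [div_mul_cancel₀ _ hr.ne', add_cu]
end
end

noncomputable section
section
variable {G : Type*} [Group G]

def Adm (c : G → G → G → ℤ) (s : G) (Q : Set ℝ) (K : Set G) : Prop :=
  Q = {0} ∨ (Q = Set.Ico 0 1 ∧ s ≠ 1 ∧
    ∀ k ∈ K, ∀ k' ∈ K, k ≠ k' → k⁻¹ * k' = s ∨ c 1 s (k⁻¹ * k') = 1)

def Rl (c : G → G → G → ℤ) (k : G) (q : ℝ) (k' : G) (q' : ℝ) : Prop :=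
  (k = k' ∧ q < q') ∨ (k ≠ k' ∧ k' ≠ 1 ∧ (k = 1 ∨ c 1 k k' = 1))

lemma lex_lt {c : G → G → G → ℤ} {ρ : G →* ↥HomeoPos} {x₀ : S1} (hst : TrivialStabilizer ρ x₀)
    (hind : ∀ g₁ g₂ g₃, inducedCO ρ x₀ g₁ g₂ g₃ = c g₁ g₂ g₃) {s : G} {Q : Set ℝ} {K : Set G}
    (h1K : (1 : G) ∈ K) (had : Adm c s Q K) {k k' : G} (hk : k ∈ K) (hk' : k' ∈ K)
    {q q' : ℝ} (hq : q ∈ Q) (hq' : q' ∈ Q) (hR : Rl c k q k' q') :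
    cu x₀ (pt ρ x₀ s k q) < cu x₀ (pt ρ x₀ s k' q') := by
  have hpos : ∀ j : G, j ≠ 1 → 0 < cu x₀ (ap (ρ j) x₀) := fun j hj =>
    cu_pos.2 (fun h => hj (hst j h))
  have ind1 : ∀ a b, c 1 a b = circOrd x₀ (ap (ρ a) x₀) (ap (ρ b) x₀) := by
    intro a b
    rw [← hind, inducedCO, map_one, ap_one]
  set r := cu x₀ (ap (ρ s) x₀) with hr
  have hr0 : 0 ≤ r := cu_nonneg _ _
  have hr1 : r < 1 := cu_lt _ _
  have hQ : ∀ q ∈ Q, 0 ≤ q ∧ q < 1 := by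
    intro q hq
    rcases had with h | h
    · rw [h] at hq; rw [Set.mem_singleton_iff.1 hq]; simp
    · rw [h.1] at hq; exact hq
  have hadm : ∀ k ∈ K, ∀ k' ∈ K, k ≠ k' → ∀ q ∈ Q, q * r < cu x₀ (ap (ρ (k⁻¹ * k')) x₀) := by
    intro k hk k' hk' hne q hq
    have hj : k⁻¹ * k' ≠ 1 := fun h => hne (inv_mul_eq_one.1 h)
    rcases had with h | ⟨h, hs, h'⟩
    · rw [h] at hq; rw [Set.mem_singleton_iff.1 hq, zero_mul]; exact hpos _ hj
    · have hrp : 0 < r := hpos s hs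
      have : q * r < r := by nlinarith [(hQ q hq).2]
      refine this.trans_le ?_
      rcases h' k hk k' hk' hne with h2 | h2
      · rw [h2]
      · rw [ind1, circOrd_base] at h2
        exact h2.2.le
  have hrpos : ∀ q ∈ Q, 0 < q → 0 < r := by
    intro q hq h0
    rcases had with h | ⟨h, hs, h'⟩
    · rw [h] at hq; rw [Set.mem_singleton_iff.1 hq] at h0; exact absurd h0 (lt_irrefl _)
    · exact hpos s hs
  have cual : ∀ q ∈ Q, cu x₀ (x₀ + ((q * r : ℝ) : S1)) = q * r := by
    intro q hq
    obtain ⟨h0, h1⟩ := hQ q hq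
    exact cu_add (by positivity) (by nlinarith)
  have A : ∀ k ∈ K, ∀ q ∈ Q, ∀ q' ∈ Q, q < q' →
      cu x₀ (pt ρ x₀ s k q) < cu x₀ (pt ρ x₀ s k q') := by
    intro k hk q hq q' hq' hqq
    have hlt : q * r < q' * r :=
      mul_lt_mul_of_pos_right hqq (hrpos q' hq' ((hQ q hq).1.trans_lt hqq))
    by_cases h : k = 1
    · subst h
      simp only [pt, map_one, ap_one]
      rw [← hr, cual q hq, cual q' hq']
      exact hlt
    · have hw := hadm k hk 1 h1K h q' hq'
      rw [mul_one] at hw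
      have : circOrd (ap (ρ k⁻¹) x₀) (x₀ + ((q * r : ℝ) : S1)) (x₀ + ((q' * r : ℝ) : S1)) = 1 := by
        rw [circOrd_cu x₀, cual q hq, cual q' hq', cyc_one_iff]
        exact Or.inr (Or.inl ⟨hlt, hw⟩)
      rw [← ap_ord (ρ k), ← ap_mul, ← map_mul, mul_inv_cancel, map_one, ap_one, circOrd_base] at this
      exact this.2
  rcases hR with ⟨rfl, h⟩ | ⟨hne, hk1, h⟩
  · exact A k hk q hq q' hq' h
  · have h0 : (0:ℝ) ∈ Q := by rcases had with h | h <;> simp [h]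
    have step2 : cu x₀ (ap (ρ k') x₀) ≤ cu x₀ (pt ρ x₀ s k' q') := by
      rw [← pt_zero ρ x₀ s]
      rcases (hQ q' hq').1.lt_or_eq with h2 | h2
      · exact (A k' hk' 0 h0 q' hq' h2).le
      · rw [← h2]
    refine lt_of_lt_of_le ?_ step2
    have hj := hadm k hk k' hk' hne q hq
    by_cases hk0 : k = 1
    · subst hk0
      simp only [pt, map_one, ap_one]
      rw [← hr, cual q hq]
      simpa using hj
    · have h := h.resolve_left hk0
      rw [ind1, circOrd_base] at h
      rcases (hQ q hq).1.lt_or_eq with h2 | h2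
      · have hq0 : 0 < q * r := mul_pos h2 (hrpos q hq h2)
        have : circOrd x₀ (x₀ + ((q * r : ℝ) : S1)) (ap (ρ (k⁻¹ * k')) x₀) = 1 := by
          rw [circOrd_base, cual q hq]
          exact ⟨hq0, hj⟩
        rw [← ap_ord (ρ k), ← ap_mul, ← map_mul, mul_inv_cancel_left, circOrd_cu x₀, cyc_one_iff]
          at this
        rcases this with h3 | h3 | h3
        · exact h3.2
        · exact h3.1
        · exact absurd h3.1 (not_lt.2 h.2.le)
      · rw [← h2, pt_zero]; exact h.2

lemma lex_iff {c c' : G → G → G → ℤ} (hc : IsCircularOrder c)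
    {ρ ρ' : G →* ↥HomeoPos} {x₀ : S1} (hst : TrivialStabilizer ρ x₀)
    (hst' : TrivialStabilizer ρ' x₀)
    (hind : ∀ g₁ g₂ g₃, inducedCO ρ x₀ g₁ g₂ g₃ = c g₁ g₂ g₃)
    (hind' : ∀ g₁ g₂ g₃, inducedCO ρ' x₀ g₁ g₂ g₃ = c' g₁ g₂ g₃) {s : G} {Q : Set ℝ} {K : Set G}
    (h1K : (1 : G) ∈ K) (had : Adm c s Q K) (had' : Adm c' s Q K)
    (hcc : ∀ k ∈ K, ∀ k' ∈ K, c' 1 k k' = c 1 k k') {k k' : G} (hk : k ∈ K) (hk' : k' ∈ K)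
    {q q' : ℝ} (hq : q ∈ Q) (hq' : q' ∈ Q) :
    cu x₀ (pt ρ x₀ s k q) < cu x₀ (pt ρ x₀ s k' q') ↔
    cu x₀ (pt ρ' x₀ s k q) < cu x₀ (pt ρ' x₀ s k' q') := by
  have tot : (k = k' ∧ q = q') ∨ Rl c k q k' q' ∨ Rl c k' q' k q := by
    by_cases h : k = k'
    · rcases lt_trichotomy q q' with h1 | h1 | h1
      · exact Or.inr (Or.inl (Or.inl ⟨h, h1⟩))
      · exact Or.inl ⟨h, h1⟩
      · exact Or.inr (Or.inr (Or.inl ⟨h.symm, h1⟩))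
    · right
      by_cases h1 : k = 1
      · left; right
        exact ⟨h, fun h2 => h (h1.trans h2.symm), Or.inl h1⟩
      by_cases h2 : k' = 1
      · right; right
        exact ⟨Ne.symm h, h1, Or.inl h2⟩
      have v := hc.2.1 1 k k'
      have z : ¬ c 1 k k' = 0 := by
        rw [hc.1]; push Not; exact ⟨Ne.symm h1, h, Ne.symm h2⟩
      have w := co_swap hc 1 k k'
      have : c 1 k k' = 1 ∨ c 1 k' k = 1 := by omega
      rcases this with h3 | h3
      · exact Or.inl (Or.inr ⟨h, h2, Or.inr h3⟩)
      · exact Or.inr (Or.inr ⟨Ne.symm h, h1, Or.inr h3⟩)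
  have tr : ∀ k ∈ K, ∀ k' ∈ K, ∀ q q', Rl c k q k' q' → Rl c' k q k' q' := by
    intro k hk k' hk' q q' h
    unfold Rl at *
    rw [hcc k hk k' hk']; exact h
  rcases tot with ⟨rfl, rfl⟩ | h | h
  · simp
  · have a := lex_lt hst hind h1K had hk hk' hq hq' h
    have b := lex_lt hst' hind' h1K had' hk hk' hq hq' (tr _ hk _ hk' _ _ h)
    exact ⟨fun _ => b, fun _ => a⟩
  · have a := lex_lt hst hind h1K had hk' hk hq' hq h
    have b := lex_lt hst' hind' h1K had' hk' hk hq' hq (tr _ hk' _ hk _ _ h)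
    exact ⟨fun h => absurd h (not_lt.2 a.le), fun h => absurd h (not_lt.2 b.le)⟩

lemma Good.adm {c : G → G → G → ℤ} {s : G} {Q : Set ℝ} (h : Good c s Q) (K : Set G) :
    Adm c s Q K := by
  rcases h with h | ⟨h1, h2, h3⟩
  · exact Or.inl h.1
  · exact Or.inr ⟨h1, h2, fun k _ k' _ hne => h3 _ (fun h => hne (inv_mul_eq_one.1 h))⟩

lemma univ_of_tight {c : G → G → G → ℤ} (hc : IsCircularOrder c) {ρ : G →* ↥HomeoPos} {x₀ : S1}
    (hst : TrivialStabilizer ρ x₀)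
    (hind : ∀ g₁ g₂ g₃, inducedCO ρ x₀ g₁ g₂ g₃ = c g₁ g₂ g₃) {s : G} {Q : Set ℝ}
    (hg : Good c s Q) (hd : DenseRange (fun z : G × Q => pt ρ x₀ s z.1 z.2)) :
    IsDynamicalRealization ρ x₀ c := by
  refine ⟨hst, hind, ?_⟩
  intro ρ' hst' hind'
  let e : G × Q := (1, ⟨0, hg.zero_mem⟩)
  have e1 : ∀ ρ : G →* ↥HomeoPos, pt ρ x₀ s e.1 e.2 = x₀ := by
    intro ρ; simp only [e, pt_zero, map_one, ap_one]
  obtain ⟨f, hf, hfa⟩ := mono_circ (fun z : G × Q => pt ρ' x₀ s z.1 z.2)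
    (fun z : G × Q => pt ρ x₀ s z.1 z.2) e (by
      intro x y
      simp only [e1]
      exact lex_iff hc hst' hst hind' hind (Set.mem_univ 1) (hg.adm _) (hg.adm _)
        (fun _ _ _ _ => rfl) (Set.mem_univ _) (Set.mem_univ _) x.2.2 y.2.2) hd
  refine ⟨f, hf, ?_, ?_⟩
  · have := hfa e
    simpa only [e1] using this
  · intro g
    apply uniq (a := fun z : G × Q => pt ρ' x₀ s z.1 z.2) ((ap_deg _).comp' hf)
      (hf.comp' (ap_deg _))
    · intro z
      simp only [Function.comp]
      rw [hfa z, pt_mul, pt_mul]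
      exact (hfa (g * z.1, z.2)).symm
    · have : (ap (ρ g) ∘ f) ∘ (fun z : G × Q => pt ρ' x₀ s z.1 z.2) =
          ap (ρ g) ∘ (fun z : G × Q => pt ρ x₀ s z.1 z.2) := by
        funext z
        simp only [Function.comp]
        rw [hfa z]
      rw [this]
      exact (ap_surj (ρ g)).denseRange.comp hd (ap_cont _)

lemma tight_of_univ [Countable G] [Nontrivial G] {c : G → G → G → ℤ} (hc : IsCircularOrder c)
    {ρ : G →* ↥HomeoPos} {x₀ : S1}
    (h : IsDynamicalRealization ρ x₀ c) {s : G} {Q : Set ℝ}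
    (hg : Good c s Q) : DenseRange (fun z : G × Q => pt ρ x₀ s z.1 z.2) := by
  obtain ⟨ρ₁, hst₁, hind₁, hd₁⟩ := exists_tight hc x₀ hg
  obtain ⟨hst, hind, huniv⟩ := h
  obtain ⟨f, hf, hf0, hfe⟩ := huniv ρ₁ hst₁ hind₁
  have hfe' : ∀ g x, f (ap (ρ₁ g) x) = ap (ρ g) (f x) := fun g x => (congrFun (hfe g) x).symm
  have hdf := hf.2.1.denseRange.comp hd₁ hf.1
  apply Dense.mono _ hdf
  rintro _ ⟨⟨g, q, hq⟩, rfl⟩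
  simp only [Function.comp]
  have key : ∃ g' : G, ∃ q' ∈ Q, f (x₀ + ((q * cu x₀ (ap (ρ₁ s) x₀) : ℝ) : S1)) =
      pt ρ x₀ s g' q' := by
    have base : x₀ = pt ρ x₀ s 1 0 := by rw [pt_zero, map_one, ap_one]
    rcases id hg with ⟨hQ, _⟩ | ⟨hQ, hs, _⟩
    · rw [hQ] at hq
      rw [Set.mem_singleton_iff.1 hq]
      refine ⟨1, 0, hg.zero_mem, ?_⟩
      rw [← base]; simpa using hf0
    · have hq2 := hq
      rw [hQ] at hq2
      have hr : 0 < cu x₀ (ap (ρ s) x₀) := cu_pos.2 (fun h => hs (hst _ h))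
      have hr₁ : 0 < cu x₀ (ap (ρ₁ s) x₀) := cu_pos.2 (fun h => hs (hst₁ _ h))
      have hr₁' := cu_lt x₀ (ap (ρ₁ s) x₀)
      set y := f (x₀ + ((q * cu x₀ (ap (ρ₁ s) x₀) : ℝ) : S1)) with hy
      by_cases h1 : y = x₀
      · exact ⟨1, 0, hg.zero_mem, h1.trans base⟩
      by_cases h2 : y = ap (ρ s) x₀
      · exact ⟨s, 0, hg.zero_mem, by rw [pt_zero]; exact h2⟩
      have hq0 : 0 < q := by
        rcases hq2.1.lt_or_eq with h | h
        · exact h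
        · exfalso; apply h1; rw [hy, ← h]; simpa using hf0
      have fs : f (ap (ρ₁ s) x₀) = ap (ρ s) x₀ := by rw [hfe', hf0]
      have hne : x₀ ≠ ap (ρ s) x₀ := fun h => hs (hst _ h.symm)
      have o := hf.2.2 x₀ (x₀ + ((q * cu x₀ (ap (ρ₁ s) x₀) : ℝ) : S1)) (ap (ρ₁ s) x₀)
        (by rw [hf0]; exact Ne.symm h1) (by rw [fs]; exact h2) (by rw [fs, hf0]; exact hne)
      rw [fs, hf0, ← hy] at o
      have o1 : circOrd x₀ (x₀ + ((q * cu x₀ (ap (ρ₁ s) x₀) : ℝ) : S1)) (ap (ρ₁ s) x₀) = 1 := by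
        rw [circOrd_base, cu_add (by positivity) (by nlinarith [hq2.2])]
        exact ⟨by positivity, by nlinarith [hq2.2]⟩
      rw [o1, circOrd_base] at o
      refine ⟨1, cu x₀ y / cu x₀ (ap (ρ s) x₀), ?_, ?_⟩
      · rw [hQ]; exact ⟨div_nonneg (cu_nonneg _ _) hr.le, (div_lt_one hr).2 o.2⟩
      · rw [pt, div_mul_cancel₀ _ hr.ne', add_cu, map_one, ap_one]
  obtain ⟨g', q', hq', hk⟩ := key
  refine ⟨(g * g', ⟨q', hq'⟩), ?_⟩
  simp only
  rw [← pt_mul, ← hk]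
  simp only [pt, hfe']

end
end

noncomputable section

lemma cut_homeo (x₀ : S1) (e : ℝ ≃o ℝ) (h0 : e 0 = 0) (h1 : e 1 = 1) :
    ∃ h : ↥HomeoPos, ∀ x, ap h x = x₀ + ((e (cu x₀ x) : ℝ) : S1) := by
  have key : ∀ e : ℝ ≃o ℝ, e 0 = 0 → e 1 = 1 →
      ∀ x, cu x₀ (x₀ + ((e (cu x₀ x) : ℝ) : S1)) = e (cu x₀ x) := by
    intro e h0 h1 x
    refine cu_add ?_ ?_
    · rw [← h0]; exact e.monotone (cu_nonneg _ _)
    · rw [← h1]; exact e.strictMono (cu_lt _ _)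
  have h0' : e.symm 0 = 0 := by rw [OrderIso.symm_apply_eq, h0]
  have h1' : e.symm 1 = 1 := by rw [OrderIso.symm_apply_eq, h1]
  have inv : ∀ e : ℝ ≃o ℝ, e 0 = 0 → e 1 = 1 → ∀ x : S1,
      x₀ + ((e.symm (cu x₀ (x₀ + ((e (cu x₀ x) : ℝ) : S1))) : ℝ) : S1) = x := by
    intro e h0 h1 x
    rw [key e h0 h1, OrderIso.symm_apply_apply, add_cu]
  have inv2 : ∀ x : S1,
      x₀ + ((e (cu x₀ (x₀ + ((e.symm (cu x₀ x) : ℝ) : S1))) : ℝ) : S1) = x := by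
    intro x
    have := inv e.symm h0' h1' x
    simpa using this
  have deg : ∀ e : ℝ ≃o ℝ, e 0 = 0 → e 1 = 1 →
      (Function.Surjective fun x : S1 => x₀ + ((e (cu x₀ x) : ℝ) : S1)) →
      DegOneMonotone (fun x : S1 => x₀ + ((e (cu x₀ x) : ℝ) : S1)) := by
    intro e h0 h1 hs
    obtain ⟨f, hf, hf'⟩ := mono_circ (fun x : S1 => x)
      (fun x : S1 => x₀ + ((e (cu x₀ x) : ℝ) : S1)) x₀ (by
        intro x y
        have hb : x₀ + ((e (cu x₀ x₀) : ℝ) : S1) = x₀ := by simp [cu_self, h0]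
        simp only [hb]
        rw [key e h0 h1, key e h0 h1]
        exact e.lt_iff_lt.symm) hs.denseRange
    have : f = (fun x : S1 => x₀ + ((e (cu x₀ x) : ℝ) : S1)) := funext hf'
    rwa [← this]
  refine ⟨mkHomeo (fun x : S1 => x₀ + ((e (cu x₀ x) : ℝ) : S1))
    (fun x : S1 => x₀ + ((e.symm (cu x₀ x) : ℝ) : S1))
    (deg e h0 h1 fun x => ⟨_, inv2 x⟩) (deg e.symm h0' h1' fun x => ⟨_, inv e h0 h1 x⟩)
    (inv e h0 h1) inv2, fun x => rfl⟩

lemma fin_homeo {ι : Type*} (W : Finset ι) (a b : ι → S1) (x₀ : S1) (i₀ : ι) (hi : i₀ ∈ W)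
    (ha : a i₀ = x₀) (hb : b i₀ = x₀)
    (h : ∀ i ∈ W, ∀ j ∈ W, cu x₀ (a i) < cu x₀ (a j) ↔ cu x₀ (b i) < cu x₀ (b j)) :
    ∃ h : ↥HomeoPos, ∀ i ∈ W, ap h (a i) = b i := by
  classical
  obtain ⟨e, he⟩ := PLfin (insert none (W.image some))
    (fun o : Option ι => o.elim 1 fun i => cu x₀ (a i))
    (fun o : Option ι => o.elim 1 fun i => cu x₀ (b i)) (by
      intro o ho p hp
      rcases o with _ | i <;> rcases p with _ | j
      · simp
      · simp [(cu_lt x₀ (a j)).not_gt, (cu_lt x₀ (b j)).not_gt]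
      · simp [cu_lt]
      · simp at ho hp
        exact h i ho j hp)
  have e1 : e 1 = 1 := he none (by simp)
  have ei : ∀ i ∈ W, e (cu x₀ (a i)) = cu x₀ (b i) := fun i hi => he (some i) (by simp [hi])
  have e0 : e 0 = 0 := by
    have := ei i₀ hi
    rwa [ha, hb, cu_self] at this
  obtain ⟨k, hk⟩ := cut_homeo x₀ e e0 e1
  exact ⟨k, fun i hi => by rw [hk, ei i hi, add_cu]⟩

section
variable {G : Type*} [Group G]

lemma conj_real {c : G → G → G → ℤ} {ρ : G →* ↥HomeoPos} {x₀ : S1}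
    (H : IsDynamicalRealization ρ x₀ c) (h : ↥HomeoPos) (hx : ap h x₀ = x₀) :
    IsDynamicalRealization ((MulAut.conj h).toMonoidHom.comp ρ) x₀ c := by
  have ev : ∀ g x, ap (((MulAut.conj h).toMonoidHom.comp ρ) g) x = ap h (ap (ρ g) (ap h⁻¹ x)) :=
    fun g x => rfl
  have hx' : ap h⁻¹ x₀ = x₀ := by
    conv_lhs => rw [← hx]
    rw [ap_inv_ap]
  obtain ⟨h1, h2, h3⟩ := H
  refine ⟨?_, ?_, ?_⟩
  · intro g hg
    rw [ev, hx'] at hg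
    apply h1
    rw [← ap_inj h, hg, hx]
  · intro a b d
    rw [← h2]
    simp only [inducedCO, ev, hx', ap_ord]
  · intro ρ' hs hi
    obtain ⟨f, hf, hf0, hfe⟩ := h3 ρ' hs hi
    refine ⟨ap h ∘ f, (ap_deg h).comp' hf, by simp [hf0, hx], ?_⟩
    intro g
    funext x
    have := congrFun (hfe g) x
    simp only [Function.comp] at this ⊢
    rw [ev, ap_inv_ap, this]
end

lemma squeeze (u v : ↥HomeoPos) (E : Set S1) (hE : ∀ p ∈ E, ap u p = ap v p) {η : ℝ}
    (h0 : 0 < η) (h1 : η ≤ 1/8) (hd : ∀ x, ∃ p ∈ E, dist p x < η) (x : S1) :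
    ∃ y, ap u x = ap v y ∧ dist y x < 6 * η := by
  have near : ∀ t : ℝ, ∃ r : ℝ, |r - t| < η ∧ x + (r : S1) ∈ E := by
    intro t
    obtain ⟨p, hp, hpd⟩ := hd (x + (t : S1))
    rw [dist_eq_norm] at hpd
    obtain ⟨w, hw, hw'⟩ := exists_lift_norm (p - (x + (t : S1)))
    refine ⟨t + w, by simpa [hw'] using hpd, ?_⟩
    have : x + ((t + w : ℝ) : S1) = p := by
      rw [AddCircle.coe_add, hw]; abel
    rwa [this]
  obtain ⟨r, hr, hrE⟩ := near (-2 * η)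
  obtain ⟨r', hr', hrE'⟩ := near (2 * η)
  rw [abs_lt] at hr hr'
  set p := x + (r : S1) with hp
  set p' := x + (r' : S1) with hp'
  have c1 : cu p x = -r := by
    have : x = p + ((-r : ℝ) : S1) := by rw [hp, AddCircle.coe_neg]; abel
    conv_lhs => rw [this]
    exact cu_add (by linarith) (by linarith)
  have c2 : cu p p' = r' - r := by
    have : p' = p + ((r' - r : ℝ) : S1) := by rw [hp, hp', AddCircle.coe_sub]; abel
    rw [this]
    exact cu_add (by linarith) (by linarith)
  have o : circOrd p x p' = 1 := by
    rw [circOrd_base, c1, c2]; constructor <;> linarith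
  refine ⟨ap v⁻¹ (ap u x), (ap_ap_inv _ _).symm, ?_⟩
  set y := ap v⁻¹ (ap u x) with hy
  have hvy : ap v y = ap u x := ap_ap_inv _ _
  have o2 : circOrd p y p' = 1 := by
    rw [← ap_ord v, hvy, ← hE p hrE, ← hE p' hrE', ap_ord, o]
  rw [circOrd_base, c2] at o2
  have : y - x = ((cu p y - cu p x : ℝ) : S1) := by
    rw [AddCircle.coe_sub]
    have a1 := add_cu p y
    have a2 := add_cu p x
    rw [← sub_eq_zero] at a1 a2 
    have := sub_eq_zero.1 (a1.trans a2.symm |> sub_eq_zero.2)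
    have a3 : (p + (cu p y : S1) - y) - (p + (cu p x : S1) - x) = 0 := by rw [this, sub_self]
    rw [← sub_eq_zero, ← neg_eq_zero, ← a3]; abel
  rw [dist_eq_norm, this]
  refine (norm_coe_le _).trans_lt ?_
  rw [abs_lt, c1]
  constructor <;> linarith [o2.1, o2.2]

section
variable {G : Type*} [Group G]

theorem main_inf [Countable G] [Nontrivial G]
    (c : G → G → G → ℤ) (hc : IsCircularOrder c)
    (ρ : G →* ↥HomeoPos) (x₀ : S1) (hρ : IsDynamicalRealization ρ x₀ c) (F : Finset G) (ε : ℝ)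
    (hε : 0 < ε) :
      ∃ S : Finset G, ∀ c' : G → G → G → ℤ, IsCircularOrder c' →
        (∀ u ∈ S, ∀ v ∈ S, ∀ w ∈ S, c' u v w = c u v w) →
        ∃ ρ' : G →* ↥HomeoPos, IsDynamicalRealization ρ' x₀ c' ∧
          ∀ g ∈ F, ∀ x : S1, dist (ap (ρ' g) x) (ap (ρ g) x) < ε := by
  classical
  haveI : Fact ((0:ℝ) < 1) := ⟨one_pos⟩
  obtain ⟨s, Q, hg⟩ := exists_good hc
  have hd := tight_of_univ hc hρ hg
  obtain ⟨δ, hδ, hδ'⟩ : ∃ δ > 0, ∀ g ∈ F, ∀ x y : S1, dist x y < δ →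
      dist (ap (ρ g) x) (ap (ρ g) y) < ε := by
    induction F using Finset.induction_on with
    | empty => exact ⟨1, one_pos, by simp⟩
    | insert a F _ ih =>
      obtain ⟨δ, h1, h2⟩ := ih
      obtain ⟨δ', h3, h4⟩ := Metric.uniformContinuous_iff.1
        (CompactSpace.uniformContinuous_of_continuous (ap_cont (ρ a))) ε hε
      refine ⟨min δ δ', lt_min h1 h3, ?_⟩
      intro g hgF x y hxy
      rcases Finset.mem_insert.1 hgF with rfl | h
      · exact h4 (hxy.trans_le (min_le_right _ _))
      · exact h2 g h x y (hxy.trans_le (min_le_left _ _))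
  obtain ⟨η, hη, hη1, hη2⟩ : ∃ η : ℝ, 0 < η ∧ η ≤ 1/8 ∧ 6 * η ≤ δ :=
    ⟨min (1/8) (δ/6), by positivity, min_le_left _ _, by linarith [min_le_right (1/8) (δ/6)]⟩
  obtain ⟨Z, hZ⟩ : ∃ Z : Finset (G × Q), ∀ x : S1, ∃ z ∈ Z, dist (pt ρ x₀ s z.1 z.2) x < η := by
    obtain ⟨Z, hZ⟩ := (isCompact_univ (X := S1)).elim_finite_subcover
      (fun z : G × Q => Metric.ball (pt ρ x₀ s z.1 z.2) η) (fun _ => Metric.isOpen_ball) (by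
        intro x _
        obtain ⟨z, hz⟩ := hd.exists_dist_lt x hη
        exact Set.mem_iUnion.2 ⟨z, hz⟩)
    refine ⟨Z, fun x => ?_⟩
    have := hZ (Set.mem_univ x)
    simp only [Set.mem_iUnion] at this
    obtain ⟨z, h1, h2⟩ := this
    exact ⟨z, h1, by rw [dist_comm]; exact h2⟩
  let W : Finset (G × Q) := insert (1, ⟨0, hg.zero_mem⟩)
    (Z ∪ (F ×ˢ Z).image fun w => (w.1 * w.2.1, w.2.2))
  let K : Finset G := W.image Prod.fst
  have h1K : (1 : G) ∈ K := Finset.mem_image.2 ⟨(1, ⟨0, hg.zero_mem⟩), by simp [W], rfl⟩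
  let S : Finset G := insert s (K ∪ (K ×ˢ K).image fun w => w.1⁻¹ * w.2)
  have KS : ∀ k ∈ K, k ∈ S := fun k hk => by simp only [S, Finset.mem_insert, Finset.mem_union]; tauto
  have KKS : ∀ k ∈ K, ∀ k' ∈ K, k⁻¹ * k' ∈ S := fun k hk k' hk' => by
    simp only [S, Finset.mem_insert, Finset.mem_union, Finset.mem_image, Finset.mem_product]
    exact Or.inr (Or.inr ⟨(k, k'), ⟨hk, hk'⟩, rfl⟩)
  have sS : s ∈ S := by simp [S]
  refine ⟨S, ?_⟩
  intro c' hc' hcc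
  have had : Adm c s Q (K : Set G) := hg.adm _
  have had' : Adm c' s Q (K : Set G) := by
    rcases had with h | ⟨ha, hb, hh⟩
    · exact Or.inl h
    · refine Or.inr ⟨ha, hb, fun k hk k' hk' hne => ?_⟩
      rw [hcc 1 (KS 1 h1K) s sS _ (KKS k hk k' hk')]
      exact hh k hk k' hk' hne
  obtain ⟨s', Q', hg'⟩ := exists_good hc'
  obtain ⟨ρ₁, hst₁, hind₁, hd₁⟩ := exists_tight hc' x₀ hg'
  have hρ₁ := univ_of_tight hc' hst₁ hind₁ hg' hd₁
  obtain ⟨h, hh⟩ := fin_homeo W (fun w => pt ρ₁ x₀ s w.1 w.2) (fun w => pt ρ x₀ s w.1 w.2) x₀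
    (1, ⟨0, hg.zero_mem⟩) (by simp [W]) (by simp [pt_zero, ap_one]) (by simp [pt_zero, ap_one]) (by
      intro i hi j hj
      exact (lex_iff hc hρ.1 hst₁ hρ.2.1 hind₁ h1K had had'
        (fun k hk k' hk' => hcc 1 (KS 1 h1K) k (KS k hk) k' (KS k' hk'))
        (Finset.mem_image_of_mem _ hi) (Finset.mem_image_of_mem _ hj) i.2.2 j.2.2).symm)
  have hx : ap h x₀ = x₀ := by
    have := hh (1, ⟨0, hg.zero_mem⟩) (by simp [W])
    simpa [pt_zero, ap_one] using this
  refine ⟨(MulAut.conj h).toMonoidHom.comp ρ₁, conj_real hρ₁ h hx, ?_⟩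
  intro g hgF x
  obtain ⟨y, hy, hyd⟩ := squeeze (((MulAut.conj h).toMonoidHom.comp ρ₁) g) (ρ g)
    {p | ∃ z ∈ Z, pt ρ x₀ s z.1 z.2 = p} (by
      rintro p ⟨z, hz, rfl⟩
      have e1 := hh z (by simp [W, hz])
      have e2 := hh (g * z.1, z.2) (by
        simp only [W, Finset.mem_insert, Finset.mem_union, Finset.mem_image, Finset.mem_product]
        exact Or.inr (Or.inr ⟨(g, z), ⟨hgF, hz⟩, rfl⟩))
      simp only at e1 e2
      change ap h (ap (ρ₁ g) (ap h⁻¹ _)) = _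
      rw [pt_mul, ← e1, ap_inv_ap, pt_mul, e2]) hη hη1 (by
      intro x
      obtain ⟨z, hz, hz'⟩ := hZ x
      exact ⟨_, ⟨z, hz, rfl⟩, hz'⟩) x
  rw [hy]
  exact hδ' g hgF y x (hyd.trans_le hη2)

theorem main_all [Countable G]
    (c : G → G → G → ℤ) (hc : IsCircularOrder c)
    (ρ : G →* ↥HomeoPos) (x₀ : S1) (hρ : IsDynamicalRealization ρ x₀ c) (F : Finset G) (ε : ℝ)
    (hε : 0 < ε) :
      ∃ S : Finset G, ∀ c' : G → G → G → ℤ, IsCircularOrder c' →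
        (∀ u ∈ S, ∀ v ∈ S, ∀ w ∈ S, c' u v w = c u v w) →
        ∃ ρ' : G →* ↥HomeoPos, IsDynamicalRealization ρ' x₀ c' ∧
          ∀ g ∈ F, ∀ x : S1, dist (ap (ρ' g) x) (ap (ρ g) x) < ε := by
  rcases subsingleton_or_nontrivial G with hG | hG
  · haveI := Fintype.ofFinite G
    refine ⟨Finset.univ, fun c' _ h => ⟨ρ, ?_, fun g _ x => by rwa [dist_self]⟩⟩
    have : c' = c := by
      funext u v w
      exact h u (Finset.mem_univ _) v (Finset.mem_univ _) w (Finset.mem_univ _)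
    rwa [this]
  · exact main_inf c hc ρ x₀ hρ F ε hε
end
end

noncomputable section
variable {G : Type*} [Group G]

/-- **Continuity of dynamical realization.**  Let `G` be a countable group, `c` a circular
order on `G`, and `ρ` a dynamical realization of `c` with basepoint `x₀`.  For every finite
`F ⊆ G` and `ε > 0` there is a finite `S ⊆ G` such that every circular order `c'` agreeing
with `c` on `S` admits a dynamical realization `ρ'` with basepoint `x₀` satisfying
`d(ρ'(g)x, ρ(g)x) < ε` for all `g ∈ F` and `x ∈ S¹`. -/
theorem dynamical_realization_continuous [Countable G]
    (c : G → G → G → ℤ) (hc : IsCircularOrder c)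
    (ρ : G →* ↥HomeoPos) (x₀ : S1) (hρ : IsDynamicalRealization ρ x₀ c) :
    ∀ (F : Finset G) (ε : ℝ), 0 < ε →
      ∃ S : Finset G, ∀ c' : G → G → G → ℤ, IsCircularOrder c' →
        (∀ u ∈ S, ∀ v ∈ S, ∀ w ∈ S, c' u v w = c u v w) →
        ∃ ρ' : G →* ↥HomeoPos, IsDynamicalRealization ρ' x₀ c' ∧
          ∀ g ∈ F, ∀ x : S1, dist (ap (ρ' g) x) (ap (ρ g) x) < ε := by
  intro F ε hε
  exact main_all c hc ρ x₀ hρ F ε hε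

end
end

section
/- For every n ≥ 1, the set of isolated points of CO(F_{2n}) is infinite; moreover there is an infinite family of isolated circular orders on F_{2n} that are pairwise non-conjugate under the conjugation action of F_{2n} on CO(F_{2n}). -/
namespace FGCO

/-! ### interpolation -/

theorem exists_interp (p : ℤ → ℝ) (hp : StrictMono p) (P : ℤ) (L : ℝ) (hL : 0 < L)
    (hper : ∀ j, p (j + P) = p j + L) :
    ∃ φ : ℝ ≃o ℝ, (∀ j : ℤ, φ (j : ℝ) = p j) ∧ ∀ x, φ (x + P) = φ x + L := by
  let f : ℝ → ℝ := fun x => p ⌊x⌋ + Int.fract x * (p (⌊x⌋ + 1) - p ⌊x⌋)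
  have hstep : ∀ j, 0 < p (j + 1) - p j := fun j => sub_pos.2 (hp (by omega))
  have hlo : ∀ x, p ⌊x⌋ ≤ f x := fun x => by
    have := mul_nonneg (Int.fract_nonneg x) (hstep ⌊x⌋).le
    simp only [f]; linarith
  have hhi : ∀ x, f x < p (⌊x⌋ + 1) := fun x => by
    have := mul_lt_mul_of_pos_right (Int.fract_lt_one x) (hstep ⌊x⌋)
    simp only [f]; linarith
  have hmono : StrictMono f := by
    intro x y hxy
    rcases (Int.floor_le_floor hxy.le).eq_or_lt with h | h
    · have h1 : Int.fract x < Int.fract y := by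
        unfold Int.fract; rw [h]; linarith
      have := mul_lt_mul_of_pos_right h1 (hstep ⌊x⌋)
      simp only [f]; rw [← h]; linarith
    · have : p (⌊x⌋ + 1) ≤ p ⌊y⌋ := hp.monotone (by omega)
      linarith [hhi x, hlo y]
  have hperm : ∀ (n : ℕ) j, p (j + n * P) = p j + n * L := by
    intro n
    induction n with
    | zero => intro j; simp
    | succ n ih =>
      intro j
      have : j + ((n + 1 : ℕ) : ℤ) * P = (j + n * P) + P := by push_cast; ring
      rw [this, hper, ih]; push_cast; ring
  have hsurj : Function.Surjective f := by
    intro y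
    have hb : ∃ b : ℤ, ∀ z : ℤ, p z ≤ y → z ≤ b := by
      obtain ⟨n, hn⟩ := exists_nat_gt ((y - p 0) / L)
      rw [div_lt_iff₀ hL] at hn
      refine ⟨0 + n * P, fun z hz => ?_⟩
      by_contra hc
      have := hp.monotone (not_le.1 hc).le
      rw [hperm] at this
      linarith
    have hi : ∃ z : ℤ, p z ≤ y := by
      obtain ⟨n, hn⟩ := exists_nat_gt ((p 0 - y) / L)
      rw [div_lt_iff₀ hL] at hn
      refine ⟨-(n * P), ?_⟩
      have := hperm n (-(n * P))
      rw [neg_add_cancel] at this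
      linarith
    obtain ⟨j, hj, hj'⟩ := Int.exists_greatest_of_bdd hb hi
    have hj2 : y < p (j + 1) := by
      by_contra hc
      have := hj' _ (not_lt.1 hc)
      omega
    have hs := hstep j
    let t : ℝ := (y - p j) / (p (j + 1) - p j)
    have ht0 : 0 ≤ t := div_nonneg (by linarith) hs.le
    have ht1 : t < 1 := by rw [div_lt_one hs]; linarith
    have hfl : ⌊(j : ℝ) + t⌋ = j := by
      rw [Int.floor_eq_iff]; constructor <;> linarith
    refine ⟨j + t, ?_⟩
    simp only [f, Int.fract, hfl]
    have : t * (p (j + 1) - p j) = y - p j := div_mul_cancel₀ _ hs.ne'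
    linarith [this, show (↑j + t - ↑j) * (p (j + 1) - p j) = t * (p (j + 1) - p j) by ring]
  refine ⟨StrictMono.orderIsoOfSurjective f hmono hsurj, fun j => ?_, fun x => ?_⟩
  · simp [f]
  · simp only [StrictMono.coe_orderIsoOfSurjective, f, Int.floor_add_intCast, Int.fract_add_intCast]
    rw [hper, show ⌊x⌋ + P + 1 = (⌊x⌋ + 1) + P by ring, hper]; ring

theorem exists_map (p q : ℤ → ℝ) (hp : StrictMono p) (hq : StrictMono q) (P : ℤ) (L : ℝ)
    (hL : 0 < L) (hpp : ∀ j, p (j + P) = p j + L) (hqp : ∀ j, q (j + P) = q j + L) :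
    ∃ f : ℝ ≃o ℝ, (∀ j : ℤ, f (p j) = q j) ∧ ∀ x, f (x + L) = f x + L := by
  obtain ⟨φ, h1, h2⟩ := exists_interp p hp P L hL hpp
  obtain ⟨ψ, h3, h4⟩ := exists_interp q hq P L hL hqp
  refine ⟨φ.symm.trans ψ, fun j => ?_, fun x => ?_⟩
  · rw [OrderIso.trans_apply, ← h1, OrderIso.symm_apply_apply, h3]
  · rw [OrderIso.trans_apply, OrderIso.trans_apply, ← h4]
    congr 1
    rw [OrderIso.symm_apply_eq, h2, OrderIso.apply_symm_apply]

/-! ### orientation cocycle on the line modulo `L` -/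

noncomputable def ar (L : ℝ) (x y : ℝ) : ℤ := ⌊(y - x) / L⌋

noncomputable def ori (L : ℝ) (x y z : ℝ) : ℤ :=
  (ar L x y - ar L y x) + (ar L y z - ar L z y) + (ar L z x - ar L x z)

theorem le_ar {L : ℝ} (hL : 0 < L) (x y : ℝ) (j : ℤ) : j ≤ ar L x y ↔ x + j * L ≤ y := by
  unfold ar
  rw [Int.le_floor, le_div_iff₀ hL]
  constructor <;> intro h <;> linarith

theorem ar_shift {L : ℝ} (hL : 0 < L) (x y : ℝ) (i j : ℤ) :
    ar L (x + i * L) (y + j * L) = ar L x y + j - i := by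
  unfold ar
  rw [show (y + j * L - (x + i * L)) / L = (y - x) / L + ((j - i : ℤ) : ℝ) by
    push_cast; field_simp; ring, Int.floor_add_intCast]
  ring

theorem ori_shift {L : ℝ} (hL : 0 < L) (x y z : ℝ) (i j k : ℤ) :
    ori L (x + i * L) (y + j * L) (z + k * L) = ori L x y z := by
  unfold ori
  simp only [ar_shift hL]
  ring

theorem ori_rot (L x y z : ℝ) : ori L y z x = ori L x y z := by
  unfold ori; ring

theorem ori_swap (L x y z : ℝ) : ori L x z y = - ori L x y z := by
  unfold ori; ring

theorem ar_eq {L : ℝ} (hL : 0 < L) {x y : ℝ} (j : ℤ) (h1 : x + j * L ≤ y)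
    (h2 : y < x + (j + 1) * L) : ar L x y = j := by
  apply le_antisymm
  · by_contra hc
    have := (le_ar hL x y (j + 1)).1 (by omega)
    push_cast at this
    linarith
  · exact (le_ar hL x y j).2 h1

theorem ori_eq_one {L : ℝ} (hL : 0 < L) {x y z : ℝ} (h1 : x < y) (h2 : y < z) (h3 : z < x + L) :
    ori L x y z = 1 := by
  unfold ori
  rw [ar_eq hL (x := x) (y := y) 0, ar_eq hL (x := y) (y := x) (-1),
    ar_eq hL (x := y) (y := z) 0, ar_eq hL (x := z) (y := y) (-1),
    ar_eq hL (x := z) (y := x) (-1), ar_eq hL (x := x) (y := z) 0] <;> 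
    first | rfl | (push_cast; linarith)

theorem exists_rep {L : ℝ} (hL : 0 < L) (x y : ℝ) :
    ∃ j : ℤ, x ≤ y + j * L ∧ y + j * L < x + L := by
  refine ⟨-ar L x y, ?_, ?_⟩
  · have := (le_ar hL x y _).1 le_rfl
    push_cast; linarith
  · by_contra hc
    have := (le_ar hL x y (ar L x y + 1)).2 (by push_cast at hc ⊢; linarith)
    omega

theorem ori_self {L : ℝ} (x y : ℝ) : ori L x x y = 0 := by
  unfold ori; ring

/-- congruence modulo `L` -/
def Cg (L x y : ℝ) : Prop := ∃ j : ℤ, y = x + j * L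

theorem ori_cases {L : ℝ} (hL : 0 < L) (x y z : ℝ) :
    ((Cg L x y ∨ Cg L y z ∨ Cg L x z) ∧ ori L x y z = 0) ∨
    (¬ (Cg L x y ∨ Cg L y z ∨ Cg L x z) ∧ (ori L x y z = 1 ∨ ori L x y z = -1)) := by
  obtain ⟨i, hi1, hi2⟩ := exists_rep hL x y
  obtain ⟨j, hj1, hj2⟩ := exists_rep hL x z
  have e := ori_shift hL x y z 0 i j
  simp only [Int.cast_zero, zero_mul, add_zero] at e
  rw [← e]
  set y' := y + i * L with hy
  set z' := z + j * L with hz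
  have key : ∀ {a b : ℝ} {k : ℤ}, a ≤ b → b < a + L → b = a + k * L → a = b := by
    intro a b k h1 h2 h3
    have : k = 0 := by
      have h4 : (k : ℝ) < 1 := by
        by_contra hc; nlinarith
      have h5 : (-1 : ℝ) < k := by
        by_contra hc; nlinarith
      have h4' : k < 1 := by exact_mod_cast h4
      have h5' : -1 < k := by exact_mod_cast h5
      omega
    subst this; simp at h3; exact h3.symm
  by_cases h1 : x = y'
  · left; refine ⟨Or.inl ⟨-i, by push_cast; linarith⟩, ?_⟩
    rw [← h1]; exact ori_self _ _
  by_cases h2 : x = z'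
  · left; refine ⟨Or.inr (Or.inr ⟨-j, by push_cast; linarith⟩), ?_⟩
    rw [← h2, ← ori_rot, ← ori_rot]; exact ori_self _ _
  by_cases h3 : y' = z'
  · left; refine ⟨Or.inr (Or.inl ⟨i - j, by push_cast; linarith⟩), ?_⟩
    rw [← h3, ← ori_rot]; exact ori_self _ _
  right
  have hxy : x < y' := lt_of_le_of_ne hi1 h1
  have hxz : x < z' := lt_of_le_of_ne hj1 h2
  constructor
  · rintro (⟨k, hk⟩ | ⟨k, hk⟩ | ⟨k, hk⟩)
    · exact h1 (key (k := k + i) hi1 hi2 (by push_cast; linarith))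
    · rcases le_total y' z' with h | h
      · exact h3 (key (k := k - i + j) h (by linarith) (by push_cast; linarith))
      · exact h3 (key (k := -(k - i + j)) h (by linarith) (by push_cast; linarith)).symm
    · exact h2 (key (k := k + j) hj1 hj2 (by push_cast; linarith))
  · rcases lt_or_gt_of_ne h3 with h | h
    · left; exact ori_eq_one hL hxy h hj2
    · right; rw [ori_swap, ori_eq_one hL hxz h hi2]

theorem map_int {L : ℝ} (f : ℝ ≃o ℝ) (hf : ∀ x, f (x + L) = f x + L) (j : ℤ) (x : ℝ) :
    f (x + j * L) = f x + j * L := by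
  have h1 : ∀ (n : ℕ) x, f (x + n * L) = f x + n * L := by
    intro n
    induction n with
    | zero => intro x; simp
    | succ n ih =>
      intro x
      rw [show x + ((n + 1 : ℕ) : ℝ) * L = (x + n * L) + L by push_cast; ring, hf, ih]
      push_cast; ring
  obtain ⟨n, rfl | rfl⟩ := j.eq_nat_or_neg
  · exact_mod_cast h1 n x
  · have := h1 n (x + ((-(n : ℤ) : ℤ) : ℝ) * L)
    rw [show x + ((-(n : ℤ) : ℤ) : ℝ) * L + n * L = x by push_cast; ring] at this
    push_cast at this ⊢; linarith

theorem ori_map {L : ℝ} (hL : 0 < L) (f : ℝ ≃o ℝ) (hf : ∀ x, f (x + L) = f x + L) (x y z : ℝ) :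
    ori L (f x) (f y) (f z) = ori L x y z := by
  have h3 : ∀ x y, ar L (f x) (f y) = ar L x y := by
    intro x y
    apply eq_of_forall_le_iff
    intro j
    rw [le_ar hL, le_ar hL, ← map_int f hf, f.le_iff_le]
  unfold ori
  simp only [h3]

end FGCO

namespace FGCO

/-! ### abstract isolation criterion -/

section iso
variable {G : Type*} [Group G]

theorem co_zero_left {c : G → G → G → ℤ} (h : IsCircularOrder c) (a b : G) : c a a b = 0 :=
  (h.1 a a b).2 (Or.inl rfl)

theorem co_zero_right {c : G → G → G → ℤ} (h : IsCircularOrder c) (a b : G) : c a b b = 0 :=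
  (h.1 a b b).2 (Or.inr (Or.inl rfl))

theorem co_zero_mid {c : G → G → G → ℤ} (h : IsCircularOrder c) (a b : G) : c a b a = 0 :=
  (h.1 a b a).2 (Or.inr (Or.inr rfl))

theorem co_swap {c : G → G → G → ℤ} (h : IsCircularOrder c) (a b d : G) :
    c a b d = - c a d b := by
  have h1 := h.2.2.1 a d b d
  have h2 := co_zero_mid h d b
  have h3 := co_zero_right h a d
  omega

theorem co_expand {c : G → G → G → ℤ} (h : IsCircularOrder c) (u x z y : G) :
    c x z y = c u z y - c u x y - c u z x := by
  have h1 := h.2.2.1 u x z y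
  have h2 := co_swap h u x z
  omega

def In (c : G → G → G → ℤ) (u v z : G) : Prop := z = u ∨ c u z v = 1
def Out (c : G → G → G → ℤ) (u v z : G) : Prop := z = v ∨ c u z v = -1

theorem co_in_out {c c' : G → G → G → ℤ} (h : IsCircularOrder c) (h' : IsCircularOrder c')
    {u v z y : G} (h1 : In c u v z) (h1' : In c' u v z)
    (h2 : Out c u v y) (h2' : Out c' u v y) : c' u z y = c u z y := by
  by_cases hz : z = u
  · subst hz; rw [co_zero_left h, co_zero_left h']
  have key : ∀ {c : G → G → G → ℤ}, IsCircularOrder c → In c u v z → Out c u v y →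
      c u z y = 1 := by
    intro c h h1 h2
    have h1 := h1.resolve_left hz
    rcases h2 with h2 | h2
    · rw [h2, h1]
    · have e1 := h.2.2.1 u z v y
      have e2 := co_swap h u v y
      have e3 := h.2.1 u z y
      have e4 := h.2.1 z v y
      omega
  rw [key h h1 h2, key h' h1' h2']

end iso

open FreeGroup in
theorem isolated_of {α : Type*} (c : FreeGroup α → FreeGroup α → FreeGroup α → ℤ)
    (hc : IsCircularOrder c) (S : Finset (FreeGroup α)) (hS1 : 1 ∈ S)
    (H : ∀ s w, IsReduced (s :: w) → ∃ u ∈ S, ∃ v ∈ S,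
      (mk [s])⁻¹ * u ∈ S ∧ (mk [s])⁻¹ * v ∈ S ∧ In c u v (mk (s :: w)) ∧
      (∀ x ∈ S, x = u ∨ Out c u v x) ∧
      (∀ s' w', IsReduced (s' :: w') → s' ≠ s → Out c u v (mk (s' :: w')))) :
    IsIsolatedCO c := by
  refine ⟨S, fun c' hc' hS => ?_⟩
  have hmk : ∀ (s : α × Bool) w, (mk (s :: w) : FreeGroup α) = mk [s] * mk w := by
    intro s w; rw [FreeGroup.mul_mk]; rfl
  have red_tail : ∀ {s : α × Bool} {w}, IsReduced (s :: w) → IsReduced w := by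
    intro s w h
    exact List.IsChain.tail h
  -- inclusion transfers, given the induction hypothesis
  have tr : ∀ (s : α × Bool) w u v, (mk [s])⁻¹ * u ∈ S → (mk [s])⁻¹ * v ∈ S →
      (∀ x ∈ S, ∀ y ∈ S, c' x (mk w) y = c x (mk w) y) → In c u v (mk (s :: w)) →
      In c' u v (mk (s :: w)) := by
    intro s w u v hu hv ih h
    rcases h with h | h
    · exact Or.inl h
    · right
      have e := ih _ hu _ hv
      rw [← hc.2.2.2 (mk [s]), ← hc'.2.2.2 (mk [s]), ← hmk] at e
      simp only [mul_inv_cancel_left] at e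
      rw [e, h]
  have trO : ∀ u ∈ S, ∀ v ∈ S, ∀ x, c' u x v = c u x v → Out c u v x → Out c' u v x := by
    intro u _ v _ x e h
    rcases h with h | h
    · exact Or.inl h
    · right; rw [e, h]
  have P1 : ∀ w : List (α × Bool), IsReduced w → ∀ x ∈ S, ∀ y ∈ S,
      c' x (mk w) y = c x (mk w) y := by
    intro w
    induction w with
    | nil => intro _ x hx y hy; exact hS x hx _ hS1 y hy
    | cons s w ih =>
      intro hw x hx y hy
      have ih := ih (red_tail hw)
      obtain ⟨u, hu, v, hv, hsu, hsv, hin, hSo, -⟩ := H s w hw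
      have hin' := tr s w u v hsu hsv ih hin
      have key : ∀ y ∈ S, c' u (mk (s :: w)) y = c u (mk (s :: w)) y := by
        intro y hy
        rcases hSo y hy with h | h
        · rw [h, co_zero_mid hc, co_zero_mid hc']
        · exact co_in_out hc hc' hin hin' h (trO u hu v hv y (hS u hu y hy v hv) h)
      rw [co_expand hc u x, co_expand hc' u x, key y hy, key x hx, hS u hu x hx y hy]
  have P2 : ∀ s w, IsReduced (s :: w) → ∀ s' w', IsReduced (s' :: w') → s' ≠ s →
      c' 1 (mk (s :: w)) (mk (s' :: w')) = c 1 (mk (s :: w)) (mk (s' :: w')) := by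
    intro s w hw s' w' hw' hne
    obtain ⟨u, hu, v, hv, hsu, hsv, hin, hSo, hO⟩ := H s w hw
    have hin' := tr s w u v hsu hsv (P1 w (red_tail hw)) hin
    have hO := hO s' w' hw' hne
    have hO' := trO u hu v hv _ (P1 _ hw' u hu v hv) hO
    rw [co_expand hc u, co_expand hc' u, co_in_out hc hc' hin hin' hO hO',
      co_swap hc u 1, co_swap hc' u 1, P1 _ hw' u hu 1 hS1, P1 _ hw u hu 1 hS1]
  have P3 : ∀ w : List (α × Bool), IsReduced w → ∀ w', IsReduced w' →
      c' 1 (mk w) (mk w') = c 1 (mk w) (mk w') := by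
    intro w
    induction w with
    | nil =>
      intro _ w' _
      rw [← FreeGroup.one_eq_mk, co_zero_left hc, co_zero_left hc']
    | cons s w ih =>
      intro hw w' hw'
      cases w' with
      | nil => rw [← FreeGroup.one_eq_mk, co_zero_mid hc, co_zero_mid hc']
      | cons s' w' =>
        by_cases hne : s' = s
        · subst hne
          have ih := ih (red_tail hw) w' (red_tail hw')
          have hs1 : (mk [s'] : FreeGroup α)⁻¹ = mk [(s'.1, !s'.2)] := by
            rw [FreeGroup.inv_mk]; rfl
          have Q : ∀ w, IsReduced (s' :: w) →
              c' 1 (mk [s'])⁻¹ (mk w) = c 1 (mk [s'])⁻¹ (mk w) := by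
            intro w hw
            cases w with
            | nil => rw [← FreeGroup.one_eq_mk, co_zero_mid hc, co_zero_mid hc']
            | cons t w =>
              rw [hs1]
              apply P2 _ _ (List.isChain_singleton _) _ _ (red_tail hw)
              rintro rfl
              have := (List.isChain_cons_cons.1 hw).1 rfl
              simp at this
          have e : ∀ {c : FreeGroup α → FreeGroup α → FreeGroup α → ℤ}, IsCircularOrder c →
              c 1 (mk (s' :: w)) (mk (s' :: w')) = c (mk [s'])⁻¹ (mk w) (mk w') := by
            intro c hc
            rw [← hc.2.2.2 (mk [s']) (mk [s'])⁻¹, ← hmk, ← hmk, mul_inv_cancel]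
          rw [e hc, e hc', co_expand hc 1, co_expand hc' 1, ih, Q _ hw',
            co_swap hc 1 (mk w) (mk [s'])⁻¹, co_swap hc' 1 (mk w) (mk [s'])⁻¹, Q _ hw]
        · exact P2 s w hw s' w' hw' hne
  classical
  have P4 : ∀ g h : FreeGroup α, c' 1 g h = c 1 g h := by
    intro g h
    have := P3 g.toWord isReduced_toWord h.toWord isReduced_toWord
    rwa [mk_toWord, mk_toWord] at this
  funext x y z
  rw [← hc.2.2.2 x⁻¹, ← hc'.2.2.2 x⁻¹, inv_mul_cancel, P4]

/-! ### endpoints -/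

def tau (N m : ℤ) : ℤ := m + m / N

theorem tau_add {N : ℤ} (hN : 0 < N) (m j : ℤ) : tau N (m + j * N) = tau N m + j * (N + 1) := by
  unfold tau
  rw [Int.add_mul_ediv_right _ _ hN.ne']; ring

theorem tau_lt {N : ℤ} (hN : 0 < N) {a b : ℤ} (h : a < b) : tau N a + (b - a) ≤ tau N b := by
  unfold tau
  have := Int.ediv_le_ediv hN h.le
  omega

theorem tau_succ {N : ℤ} (hN : 0 < N) {m : ℤ} (h : ¬ N ∣ m + 1) : tau N (m + 1) = tau N m + 1 := by
  unfold tau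
  have h1 := Int.emod_add_mul_ediv m N
  have h2 := Int.emod_nonneg m hN.ne'
  have h3 := Int.emod_lt_of_pos m hN
  have h4 : m % N + 1 ≠ N := by
    intro h4
    apply h
    exact ⟨m / N + 1, by linear_combination h4 - h1⟩
  have : (m + 1) / N = m / N := by
    rw [Int.ediv_eq_iff_of_pos hN]
    constructor <;> nlinarith [show m % N + 1 < N by omega]
  omega

theorem tau_mul {N : ℤ} (hN : 0 < N) (j : ℤ) : tau N (j * N) = j * (N + 1) := by
  have := tau_add hN 0 j
  simpa [tau] using this

theorem tau_neg_one {N : ℤ} (hN : 0 < N) : tau N (-1) = -2 := by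
  unfold tau
  rw [Int.neg_one_ediv, Int.sign_eq_one_of_pos hN]; rfl

/-- the integer points `tau m`, `tau m + 1` are disjoint from the base point class -/
theorem tau_ne {N : ℤ} (hN : 0 < N) (m j : ℤ) : tau N m ≠ -1 + j * (N + 1) := by
  intro h
  have h2 := tau_mul hN j
  rcases lt_trichotomy m (j * N) with h1 | h1 | h1
  · have h3 := tau_lt hN (show m < j * N from h1)
    have h4 : tau N (j * N - 1) = j * (N + 1) - 2 := by
      have := tau_add hN (-1) j
      rw [tau_neg_one hN] at this
      rw [show j * N - 1 = -1 + j * N by ring, this]; ring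
    rcases eq_or_lt_of_le (show m ≤ j * N - 1 by omega) with h5 | h5
    · rw [h5] at h; omega
    · have := tau_lt hN h5; omega
  · rw [h1] at h; omega
  · have h3 := tau_lt hN h1; omega

end FGCO

namespace FGCO

theorem tau_inj' {N : ℤ} (hN : 0 < N) {a b : ℤ} {x : ℝ} (h1 : (tau N a : ℝ) ≤ x)
    (h2 : x < tau N a + 1) (h3 : (tau N b : ℝ) ≤ x) (h4 : x < tau N b + 1) : a = b := by
  have e1 : tau N a < tau N b + 1 := by
    have : (tau N a : ℝ) < tau N b + 1 := by linarith
    exact_mod_cast this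
  have e2 : tau N b < tau N a + 1 := by
    have : (tau N b : ℝ) < tau N a + 1 := by linarith
    exact_mod_cast this
  rcases lt_trichotomy a b with h | h | h
  · have := tau_lt hN h; omega
  · exact h
  · have := tau_lt hN h; omega

def label (D : ℕ) (s : Fin D × Bool) : ℤ := if s.2 then (s.1 : ℤ) else (s.1 : ℤ) + D

theorem label_ne {D : ℕ} {s s' : Fin D × Bool} (h : (2 * D : ℤ) ∣ label D s - label D s') :
    s = s' := by
  obtain ⟨⟨a, ha⟩, b⟩ := s
  obtain ⟨⟨a', ha'⟩, b'⟩ := s'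
  obtain ⟨t, ht⟩ := h
  have ht0 : t = 0 := by
    have h1 : t < 1 := by
      by_contra hc
      have : (2 * D : ℤ) * 1 ≤ 2 * D * t := mul_le_mul_of_nonneg_left (by omega) (by omega)
      cases b <;> cases b' <;> simp [label] at ht <;> omega
    have h2 : -1 < t := by
      by_contra hc
      have : (2 * D : ℤ) * t ≤ 2 * D * (-1) := mul_le_mul_of_nonneg_left (by omega) (by omega)
      cases b <;> cases b' <;> simp [label] at ht <;> omega
    omega
  subst ht0
  cases b <;> cases b' <;> simp [label] at ht ⊢ <;> omega

theorem label_inv {D : ℕ} {s s' : Fin D × Bool} (h : (2 * D : ℤ) ∣ label D s - label D s' - D) :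
    s.1 = s'.1 ∧ s.2 ≠ s'.2 := by
  have : s = (s'.1, !s'.2) := by
    apply label_ne
    obtain ⟨⟨a', ha'⟩, b'⟩ := s'
    cases b'
    · simp [label] at h ⊢
      obtain ⟨t, ht⟩ := h
      exact ⟨t + 1, by linarith⟩
    · simp [label] at h ⊢
      obtain ⟨t, ht⟩ := h
      exact ⟨t, by linarith⟩
  subst this
  simp

def pt (N D i j : ℤ) : ℤ := tau N (i + 2 * D * (j / 2)) + j % 2

theorem pt_mono {N D : ℤ} (hN : 0 < N) (hD : 2 ≤ D) (i : ℤ) : StrictMono (pt N D i) := by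
  apply strictMono_int_of_lt_succ
  intro j
  unfold pt
  rcases Int.emod_two_eq_zero_or_one j with h | h
  · rw [show (j + 1) / 2 = j / 2 by omega]; omega
  · rw [show (j + 1) / 2 = j / 2 + 1 by omega]
    have := tau_lt hN (show i + 2 * D * (j / 2) < i + 2 * D * (j / 2 + 1) by linarith)
    have e : 2 * D * (j / 2 + 1) = 2 * D * (j / 2) + 2 * D := by ring
    omega

theorem pt_per {N D : ℤ} (hN : 0 < N) (k : ℤ) (hk : N = 2 * D * k) (i j : ℤ) :
    pt N D i (j + 2 * k) = pt N D i j + (N + 1) := by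
  unfold pt
  rw [show (j + 2 * k) / 2 = j / 2 + k by omega, show (j + 2 * k) % 2 = j % 2 by omega,
    show i + 2 * D * (j / 2 + k) = i + 2 * D * (j / 2) + 1 * N by rw [hk]; ring, tau_add hN]
  ring

theorem exists_gen {N D k : ℤ} (hN : 0 < N) (hD : 2 ≤ D) (hk : N = 2 * D * k) (i : ℤ) :
    ∃ f : ℝ ≃o ℝ, (∀ x, f (x + (N + 1)) = f x + (N + 1)) ∧
      ∀ m, 2 * D ∣ m - i - D → f (tau N m) = tau N (m - D) + 1 ∧
        f (tau N m + 1) = tau N (m + D) := by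
  obtain ⟨f, h1, h2⟩ := exists_map (fun j => (pt N D (i + D) j : ℝ))
    (fun j => (pt N D i (j + 1) : ℝ))
    (fun a b h => Int.cast_lt.2 (pt_mono hN hD _ h))
    (fun a b h => Int.cast_lt.2 (pt_mono hN hD _ (by omega))) (2 * k) (N + 1)
    (by have : (0 : ℝ) < N := by exact_mod_cast hN
        linarith)
    (fun j => by rw [pt_per hN k hk]; push_cast; ring)
    (fun j => by rw [show j + 2 * k + 1 = j + 1 + 2 * k by ring, pt_per hN k hk]; push_cast; ring)
  refine ⟨f, h2, fun m hm => ?_⟩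
  obtain ⟨j, hj⟩ := hm
  have a1 := h1 (2 * j)
  have a2 := h1 (2 * j + 1)
  have hm : m = i + D + 2 * D * j := by linarith
  simp only [pt] at a1 a2
  rw [show (2 * j) / 2 = j by omega, show (2 * j) % 2 = 0 by omega, 
    show (2 * j + 1) / 2 = j by omega, show (2 * j + 1) % 2 = 1 by omega, ← hm,
    show i + 2 * D * j = m - D by linarith] at a1
  rw [show (2 * j + 1 + 1) / 2 = j + 1 by omega, show (2 * j + 1 + 1) % 2 = 0 by omega, 
    show (2 * j + 1) / 2 = j by omega, show (2 * j + 1) % 2 = 1 by omega, ← hm,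
    show i + 2 * D * (j + 1) = m + D by linarith] at a2
  push_cast at a1 a2
  simp only [add_zero] at a1 a2
  exact ⟨a1, a2⟩

open FreeGroup in
theorem exists_action {D : ℕ} {N k : ℤ} (hN : 0 < N) (hD : 2 ≤ D) (hk : N = 2 * D * k) :
    ∃ ρ : FreeGroup (Fin D) →* (ℝ ≃o ℝ), (∀ g x, ρ g (x + (N + 1)) = ρ g x + (N + 1)) ∧
      ∀ s q, (2 * D : ℤ) ∣ q - label D s →
        ρ (mk [s]) (tau N (q - D) + 1) = tau N q ∧ ρ (mk [s]) (tau N (q + D)) = tau N q + 1 := by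
  choose f hf1 hf2 using fun i : Fin D => exists_gen (D := D) hN (by omega) hk ((i : ℕ) : ℤ)
  refine ⟨FreeGroup.lift f, ?_, ?_⟩
  · intro g
    induction g using FreeGroup.induction_on with
    | C1 => intro x; simp
    | of a => intro x; simpa using hf1 a x
    | inv_of a ih =>
      intro x
      rw [_root_.map_inv, FreeGroup.lift_apply_of]
      apply (f a).injective
      rw [hf1, RelIso.apply_inv_self, RelIso.apply_inv_self]
    | mul a b ha hb =>
      intro x
      rw [_root_.map_mul, RelIso.mul_apply, RelIso.mul_apply, hb, ha]
  · rintro ⟨a, b⟩ q hq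
    obtain ⟨j, hj⟩ := hq
    cases b
    · have e : (mk [(a, false)] : FreeGroup (Fin D)) = (FreeGroup.of a)⁻¹ := rfl
      rw [e, _root_.map_inv, FreeGroup.lift_apply_of]
      simp only [label] at hj
      have a1 := hf2 a q ⟨j, by simpa [sub_sub] using hj⟩
      constructor
      · apply (f a).injective
        rw [RelIso.apply_inv_self, a1.1]
      · apply (f a).injective
        rw [RelIso.apply_inv_self, a1.2]
    · have e : (mk [(a, true)] : FreeGroup (Fin D)) = FreeGroup.of a := rfl
      rw [e, FreeGroup.lift_apply_of]
      simp only [label] at hj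
      have a1 := hf2 a (q - D) ⟨j - 1, by simp at hj; linarith⟩
      have a2 := hf2 a (q + D) ⟨j, by simp at hj; linarith⟩
      rw [sub_add_cancel] at a1
      rw [add_sub_cancel_right] at a2
      exact ⟨a1.2, a2.1⟩

/-! ### the boundary word -/

def lett (D : ℕ) (hD : 2 ≤ D) (m : ℕ) : Fin D × Bool :=
  if h : m % (2 * D) < D then (⟨m % (2 * D), h⟩, true)
  else (⟨m % (2 * D) - D, by have := Nat.mod_lt m (show 0 < 2 * D by omega); omega⟩, false)

theorem label_lett (D : ℕ) (hD : 2 ≤ D) (m : ℕ) : label D (lett D hD m) = ((m % (2 * D) : ℕ) : ℤ) := by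
  unfold lett label
  split_ifs with h1 h2 h2
  · simp
  · simp at h2
  · simp at h2
  · simp only; omega

theorem label_lett_dvd (D : ℕ) (hD : 2 ≤ D) (m : ℕ) : (2 * D : ℤ) ∣ m - label D (lett D hD m) := by
  rw [label_lett]
  push_cast
  exact Int.dvd_self_sub_emod

def Tl (D : ℕ) (hD : 2 ≤ D) : ℕ → List (Fin D × Bool)
  | 0 => []
  | r + 1 => lett D hD ((r + 1) * (D - 1)) :: Tl D hD r

theorem Tl_length (D : ℕ) (hD : 2 ≤ D) (r : ℕ) : (Tl D hD r).length = r := by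
  induction r with
  | zero => rfl
  | succ r ih => simp [Tl, ih]

open FreeGroup in
theorem Tl_red (D : ℕ) (hD : 2 ≤ D) : ∀ r, IsReduced (Tl D hD r)
  | 0 => IsReduced.nil
  | 1 => IsReduced.singleton
  | r + 2 => by
    have ih := Tl_red D hD (r + 1)
    simp only [Tl] at ih ⊢
    rw [FreeGroup.isReduced_cons_cons]
    refine ⟨fun h => ?_, ih⟩
    by_contra hne
    have e : lett D hD ((r + 1 + 1) * (D - 1)) = 
        ((lett D hD ((r + 1) * (D - 1))).1, !(lett D hD ((r + 1) * (D - 1))).2) := by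
      ext1
      · exact h
      · simp only; revert hne
        cases (lett D hD ((r + 1 + 1) * (D - 1))).2 <;>
        cases (lett D hD ((r + 1) * (D - 1))).2 <;> simp
    have l1 := label_lett_dvd D hD ((r + 1 + 1) * (D - 1))
    have l2 := label_lett_dvd D hD ((r + 1) * (D - 1))
    rw [e] at l1
    generalize lett D hD ((r + 1) * (D - 1)) = s at l1 l2
    have l3 : (2 * D : ℤ) ∣ label D (s.1, !s.2) - label D s - D := by
      obtain ⟨a, b⟩ := s
      cases b
      · exact ⟨-1, by simp [label]; ring⟩
      · exact ⟨0, by simp [label]⟩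
    have l4 := dvd_add (dvd_sub l1 l2) l3
    have l5 : (((r + 1 + 1) * (D - 1) : ℕ) : ℤ) = ((r + 1) * (D - 1) : ℕ) + D - 1 := by
      rw [show (r + 1 + 1) * (D - 1) = (r + 1) * (D - 1) + (D - 1) by ring]
      push_cast [Nat.cast_sub (show 1 ≤ D by omega)]; ring
    rw [l5] at l4
    have l6 : (2 * D : ℤ) ∣ 1 := by
      rw [← dvd_neg]; convert l4 using 1; ring
    have := Int.le_of_dvd one_pos l6
    omega

open FreeGroup in
theorem norm_T (D : ℕ) (hD : 2 ≤ D) (r : ℕ) : norm (mk (Tl D hD r)) = r := by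
  rw [FreeGroup.norm, toWord_mk, (Tl_red D hD r).reduce_eq, Tl_length]

open FreeGroup in
theorem T_add (D : ℕ) (hD : 2 ≤ D) (M : ℕ) (hM : 2 * D ∣ M) (r : ℕ) :
    mk (Tl D hD (r + M)) = mk (Tl D hD r) * mk (Tl D hD M) := by
  induction r with
  | zero => simp [Tl, ← FreeGroup.one_eq_mk]
  | succ r ih =>
    have e : lett D hD ((r + M + 1) * (D - 1)) = lett D hD ((r + 1) * (D - 1)) := by
      obtain ⟨t, rfl⟩ := hM
      have : ((r + 2 * D * t + 1) * (D - 1)) % (2 * D) = ((r + 1) * (D - 1)) % (2 * D) := by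
        rw [show (r + 2 * D * t + 1) * (D - 1) = (r + 1) * (D - 1) + 2 * D * (t * (D - 1)) by ring,
          Nat.add_mul_mod_self_left]
      unfold lett
      simp only [this]
    rw [show r + 1 + M = (r + M) + 1 by ring]
    simp only [Tl]
    have hmk : ∀ (s : Fin D × Bool) w, (mk (s :: w) : FreeGroup (Fin D)) = mk [s] * mk w :=
      fun s w => by rw [FreeGroup.mul_mk]; rfl
    rw [e, hmk _ (Tl D hD (r + M)), hmk _ (Tl D hD r), ih, mul_assoc]

open FreeGroup in
theorem T_pow (D : ℕ) (hD : 2 ≤ D) (M : ℕ) (hM : 2 * D ∣ M) (r : ℕ) :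
    (mk (Tl D hD M)) ^ r = mk (Tl D hD (r * M)) := by
  induction r with
  | zero => simp [Tl, ← FreeGroup.one_eq_mk]
  | succ r ih => rw [pow_succ, ih, ← T_add D hD M hM]; congr 2; ring

open FreeGroup in
theorem T_conj (D : ℕ) (hD : 2 ≤ D) (M M' : ℕ) (hM : 2 * D ∣ M) (hM' : 2 * D ∣ M')
    (g : FreeGroup (Fin D)) (h : mk (Tl D hD M) = g⁻¹ * mk (Tl D hD M') * g) : M ≤ M' := by
  by_contra hc
  have key : ∀ r : ℕ, r * M ≤ r * M' + 2 * norm g := by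
    intro r
    have e : (mk (Tl D hD M)) ^ r = g⁻¹ * (mk (Tl D hD M')) ^ r * g := by
      have := conj_pow (i := r) (a := g⁻¹) (b := mk (Tl D hD M'))
      rw [inv_inv] at this
      rw [h, this]
    rw [T_pow D hD M hM, T_pow D hD M' hM'] at e
    have e2 := congrArg FreeGroup.norm e
    rw [norm_T] at e2
    have h1 := norm_mul_le (g⁻¹ * mk (Tl D hD (r * M'))) g
    have h2 := norm_mul_le g⁻¹ (mk (Tl D hD (r * M')))
    rw [norm_T, norm_inv_eq] at h2
    omega
  have := key (2 * norm g + 1)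
  have h3 : (2 * norm g + 1) * (M' + 1) ≤ (2 * norm g + 1) * M := Nat.mul_le_mul_left _ (by omega)
  rw [Nat.mul_add] at h3
  omega

end FGCO

namespace FGCO

theorem exists_slot {N D : ℤ} (hN : 0 < N) (hD : 2 ≤ D) (i : ℤ) (x : ℝ)
    (hx : ∀ q, 2 * D ∣ q - i - D → ¬ ((tau N q : ℝ) ≤ x ∧ x < tau N q + 1)) :
    ∃ m, 2 * D ∣ m - i ∧ (tau N (m - D) : ℝ) + 1 ≤ x ∧ x < tau N (m + D) := by
  have hpos : ∀ a : ℤ, 0 ≤ a → a ≤ tau N a := by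
    intro a ha
    unfold tau
    have := Int.ediv_nonneg ha hN.le
    omega
  have hneg : ∀ a : ℤ, a ≤ 0 → tau N a ≤ a := by
    intro a ha
    unfold tau
    have := Int.ediv_le_ediv hN ha
    simp at this
    omega
  obtain ⟨B, hB⟩ := exists_int_gt |x|
  have hB0 : 0 < B := by
    have : (0 : ℝ) < B := lt_of_le_of_lt (abs_nonneg x) hB
    exact_mod_cast this
  have hb : ∃ b : ℤ, ∀ z : ℤ, (tau N (i + D + 2 * D * z) : ℝ) ≤ x → z ≤ b := by
    refine ⟨B + |i|, fun z hz => ?_⟩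
    by_contra hc
    have h1 : B + |i| ≤ z := by omega
    have h2 := neg_abs_le i
    have h3 : z ≤ D * z := by nlinarith [abs_nonneg i]
    have h4 : B ≤ i + D + 2 * D * z := by nlinarith [abs_nonneg i]
    have h5 := hpos _ (by omega : 0 ≤ i + D + 2 * D * z)
    have h6 : (B : ℝ) ≤ tau N (i + D + 2 * D * z) := by exact_mod_cast h4.trans h5
    linarith [le_abs_self x]
  have hi : ∃ z : ℤ, (tau N (i + D + 2 * D * z) : ℝ) ≤ x := by
    refine ⟨-(B + |i| + 1), ?_⟩
    have h2 := le_abs_self i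
    have h3 : (B + |i|) ≤ D * (B + |i|) := by nlinarith [abs_nonneg i]
    have h4 : i + D + 2 * D * (-(B + |i| + 1)) ≤ -B := by nlinarith [abs_nonneg i]
    have h5 := hneg _ (by omega : i + D + 2 * D * (-(B + |i| + 1)) ≤ 0)
    have h6 : (tau N (i + D + 2 * D * (-(B + |i| + 1))) : ℝ) ≤ ((-B : ℤ) : ℝ) := by
      exact_mod_cast h5.trans h4
    push_cast at h6
    push_cast
    linarith [neg_abs_le x]
  obtain ⟨j, hj, hj'⟩ := Int.exists_greatest_of_bdd hb hi
  have hj2 : x < tau N (i + D + 2 * D * (j + 1)) := by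
    by_contra hc
    have := hj' _ (not_lt.1 hc)
    omega
  refine ⟨i + 2 * D * (j + 1), ⟨j + 1, by ring⟩, ?_, ?_⟩
  · have := hx (i + D + 2 * D * j) ⟨j, by ring⟩
    rw [show i + 2 * D * (j + 1) - D = i + D + 2 * D * j by ring]
    by_contra hc
    exact this ⟨hj, not_le.1 hc⟩
  · rw [show i + 2 * D * (j + 1) + D = i + D + 2 * D * (j + 1) by ring]; exact hj2

open FreeGroup in
theorem main_k (D k : ℕ) (hD : 2 ≤ D) (hk : 1 ≤ k) (cop : Nat.Coprime (D - 1) (2 * D * k)) :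
    ∃ c : FreeGroup (Fin D) → FreeGroup (Fin D) → FreeGroup (Fin D) → ℤ,
      IsCircularOrder c ∧ IsIsolatedCO c ∧
      ∀ x, x ≠ 1 → x ≠ mk (Tl D hD (2 * D * k)) → c 1 (mk (Tl D hD (2 * D * k))) x = 1 := by
  classical
  obtain ⟨Nn, hNn⟩ : ∃ Nn : ℕ, Nn = 2 * D * k := ⟨_, rfl⟩
  rw [← hNn] at cop ⊢
  have hNn0 : 0 < Nn := by rw [hNn]; positivity
  obtain ⟨N, hNN⟩ : ∃ N : ℤ, N = Nn := ⟨_, rfl⟩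
  have hN : 0 < N := by omega
  have hNk : N = 2 * D * k := by rw [hNN, hNn]; push_cast; ring
  have hDN : (2 * D : ℤ) ∣ N := ⟨k, hNk⟩
  obtain ⟨ρ, hρ1, hρ2⟩ := exists_action (D := D) hN hD hNk
  have hL : (0 : ℝ) < (N : ℝ) + 1 := by
    have : (0 : ℝ) < N := by exact_mod_cast hN
    linarith
  obtain ⟨L, hLe⟩ : ∃ L : ℝ, L = (N : ℝ) + 1 := ⟨_, rfl⟩
  rw [← hLe] at hρ1 hL
  have hρL : ∀ g (j : ℤ) x, ρ g (x + j * L) = ρ g x + j * L := fun g j x =>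
    map_int (ρ g) (hρ1 g) j x
  have hmk : ∀ (s : Fin D × Bool) w, (mk (s :: w) : FreeGroup (Fin D)) = mk [s] * mk w :=
    fun s w => by rw [FreeGroup.mul_mk]; rfl
  have tauL : ∀ m j : ℤ, (tau N m : ℝ) + j * L = tau N (m + j * N) := by
    intro m j
    rw [tau_add hN, hLe]; push_cast; ring
  -- no `tau` is congruent to the base point
  have base_ne : ∀ m j : ℤ, ¬ ((tau N m : ℝ) ≤ -1 + j * L ∧ (-1 : ℝ) + j * L < tau N m + 1) := by
    rintro m j ⟨h1, h2⟩
    rw [hLe] at h1 h2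
    have h1' : tau N m ≤ -1 + j * (N + 1) := by exact_mod_cast h1
    have h2' : -1 + j * (N + 1) < tau N m + 1 := by exact_mod_cast h2
    exact tau_ne hN m j (by omega)
  have ping : ∀ w s, IsReduced (s :: w) → ∃ m, (2 * D : ℤ) ∣ m - label D s ∧
      (tau N m : ℝ) ≤ ρ (mk (s :: w)) (-1) ∧ ρ (mk (s :: w)) (-1) < tau N m + 1 := by
    intro w
    induction w with
    | nil =>
      intro s _
      obtain ⟨m, hm, h1, h2⟩ := exists_slot (D := D) hN (by omega) (label D s) (-1) (by
        intro q _ h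
        have := base_ne q 0
        simp only [Int.cast_zero, zero_mul, add_zero] at this
        exact this h)
      obtain ⟨e1, e2⟩ := hρ2 s m hm
      refine ⟨m, hm, ?_, ?_⟩
      · rw [← e1]; exact (ρ _).monotone h1
      · rw [← e2]; exact (ρ _).strictMono h2
    | cons s' w ih =>
      intro s hred
      obtain ⟨hr1, hr2⟩ := FreeGroup.isReduced_cons_cons.1 hred
      obtain ⟨m', hm', g1, g2⟩ := ih s' hr2
      obtain ⟨m, hm, h1, h2⟩ := exists_slot (D := D) hN (by omega) (label D s)
        (ρ (mk (s' :: w)) (-1)) (by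
        rintro q hq ⟨h1, h2⟩
        have := tau_inj' hN g1 g2 h1 h2
        subst this
        have h3 : (2 * D : ℤ) ∣ label D s' - label D s - D := by
          have h6 := dvd_sub hq hm'
          ring_nf at h6 ⊢
          exact h6
        obtain ⟨h4, h5⟩ := label_inv h3
        exact h5 (hr1 h4.symm).symm)
      obtain ⟨e1, e2⟩ := hρ2 s m hm
      rw [hmk s, _root_.map_mul, RelIso.mul_apply]
      refine ⟨m, hm, ?_, ?_⟩
      · rw [← e1]; exact (ρ _).monotone h1
      · rw [← e2]; exact (ρ _).strictMono h2
  have free : ∀ g (j : ℤ), ρ g (-1) = -1 + j * L → g = 1 := by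
    intro g j hg
    rw [← mk_toWord (x := g)] at hg ⊢
    have hr := isReduced_toWord (x := g)
    cases hw : g.toWord with
    | nil => rfl
    | cons s w =>
      rw [hw] at hg hr
      obtain ⟨m, -, h1, h2⟩ := ping w s hr
      rw [hg] at h1 h2
      exact absurd ⟨h1, h2⟩ (base_ne m j)
  have inj : ∀ g h, Cg L (ρ g (-1)) (ρ h (-1)) → g = h := by
    rintro g h ⟨j, hj⟩
    have : g⁻¹ * h = 1 := by
      apply free _ j
      rw [_root_.map_mul, RelIso.mul_apply, hj, ← hρL, _root_.map_inv, RelIso.inv_apply_self]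
    exact (inv_mul_eq_one.1 this)
  let c : FreeGroup (Fin D) → FreeGroup (Fin D) → FreeGroup (Fin D) → ℤ :=
    fun g h k => ori L (ρ g (-1)) (ρ h (-1)) (ρ k (-1))
  have cg_iff : ∀ g h, Cg L (ρ g (-1)) (ρ h (-1)) ↔ g = h :=
    fun g h => ⟨inj g h, fun e => ⟨0, by rw [e]; simp⟩⟩
  have hc : IsCircularOrder c := by
    refine ⟨?_, ?_, ?_, ?_⟩
    · intro a b d
      have := ori_cases hL (ρ a (-1)) (ρ b (-1)) (ρ d (-1))
      simp only [cg_iff] at this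
      constructor
      · intro h
        rcases this with h1 | ⟨-, h1 | h1⟩
        · exact h1.1
        · simp only [c] at h; omega
        · simp only [c] at h; omega
      · intro h
        rcases this with h1 | h1
        · exact h1.2
        · exact absurd h h1.1
    · intro a b d
      have := ori_cases hL (ρ a (-1)) (ρ b (-1)) (ρ d (-1))
      simp only [c]; tauto
    · intro a b d e
      simp only [c, ori]; ring
    · intro g u v w
      simp only [c, _root_.map_mul, RelIso.mul_apply]
      exact ori_map hL _ (hρ1 g) _ _ _
  -- positions of the words `T r`
  have cop' : IsCoprime ((D : ℤ) - 1) N := by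
    have := Nat.isCoprime_iff_coprime.2 cop
    rw [Nat.cast_sub (by omega)] at this
    rw [hNN]; exact_mod_cast this
  have PT : ∀ r : ℕ, r + 1 ≤ Nn → ρ (mk (Tl D hD (r + 1))) (-1) = tau N ((r + 1) * (D - 1)) := by
    intro r
    induction r with
    | zero =>
      intro _
      have := (hρ2 (lett D hD (1 * (D - 1))) (((1 * (D - 1) : ℕ)) : ℤ) (label_lett_dvd D hD _)).1
      have e : (((1 * (D - 1) : ℕ)) : ℤ) = D - 1 := by omega
      rw [e, show (D : ℤ) - 1 - D = -1 by ring, tau_neg_one hN] at this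
      simp only [Tl, zero_add]
      norm_num at this ⊢
      exact this
    | succ r ih =>
      intro hr
      have ih := ih (by omega)
      have e : ((((r + 1 + 1) * (D - 1) : ℕ)) : ℤ) = (r + 1 + 1) * (D - 1) := by
        push_cast [Nat.cast_sub (show 1 ≤ D by omega)]; ring
      have := (hρ2 (lett D hD ((r + 1 + 1) * (D - 1))) (((r + 1 + 1) * (D - 1) : ℕ) : ℤ)
        (label_lett_dvd D hD _)).1
      rw [e] at this
      have hnd : ¬ N ∣ (((r : ℤ) + 1 + 1) * (D - 1) - D) + 1 := by
        intro hd
        rw [show (((r : ℤ) + 1 + 1) * (D - 1) - D) + 1 = (r + 1) * (D - 1) by ring] at hd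
        have := Int.le_of_dvd (by omega) (cop'.symm.dvd_of_dvd_mul_right hd)
        omega
      have e3 := tau_succ hN hnd
      rw [show (((r : ℤ) + 1 + 1) * (D - 1) - D) + 1 = (r + 1) * (D - 1) by ring] at e3
      have e4 : (tau N (((r : ℤ) + 1 + 1) * (D - 1) - D) : ℝ) + 1 = tau N ((r + 1) * (D - 1)) := by
        exact_mod_cast e3.symm
      rw [e4, ← ih] at this
      rw [show Tl D hD (r + 1 + 1) = lett D hD ((r + 1 + 1) * (D - 1)) :: Tl D hD (r + 1) from rfl,
        hmk, _root_.map_mul, RelIso.mul_apply, this]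
      push_cast; rfl
  let S : Finset (FreeGroup (Fin D)) := (Finset.range (Nn + 1)).image fun r => mk (Tl D hD r)
  have hS1 : 1 ∈ S := Finset.mem_image.2 ⟨0, by simp, rfl⟩
  have hSint : ∀ x ∈ S, ∃ z : ℤ, ρ x (-1) = z := by
    intro x hx
    obtain ⟨r, hr, rfl⟩ := Finset.mem_image.1 hx
    rw [Finset.mem_range] at hr
    cases r with
    | zero =>
      refine ⟨-1, ?_⟩
      rw [show mk (Tl D hD 0) = (1 : FreeGroup (Fin D)) from rfl, _root_.map_one]
      simp
    | succ r => exact ⟨_, PT r (by omega)⟩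
  have hStau : ∀ m, ∃ u ∈ S, ∃ j : ℤ, ρ u (-1) = tau N m + j * L := by
    intro m
    obtain ⟨a, b, hab⟩ := cop'
    let r0 : ℤ := (m * a - 1) % N
    have h0 : 0 ≤ r0 := Int.emod_nonneg _ hN.ne'
    have h1 : r0 < N := Int.emod_lt_of_pos _ hN
    have h2 : r0 = (m * a - 1) - N * ((m * a - 1) / N) := by
      have := Int.emod_add_mul_ediv (m * a - 1) N
      simp only [r0]; linarith
    obtain ⟨r, hr⟩ := Int.eq_ofNat_of_zero_le h0
    refine ⟨mk (Tl D hD (r + 1)), Finset.mem_image.2 ⟨r + 1, by rw [Finset.mem_range]; omega, rfl⟩,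
      -(m * b) - ((m * a - 1) / N) * (D - 1), ?_⟩
    rw [PT r (by omega), tauL]
    congr 2
    rw [← hr, h2]
    linear_combination m * hab
  have hSe : ∀ m, ∃ u ∈ S, ∃ j : ℤ, ρ u (-1) = tau N m + 1 + j * L := by
    intro m
    by_cases hd : N ∣ m + 1
    · obtain ⟨j, hj⟩ := hd
      refine ⟨1, hS1, -j, ?_⟩
      have : m = -1 + j * N := by linarith
      rw [this, ← tauL, tau_neg_one hN, _root_.map_one]
      push_cast
      simp only [RelIso.coe_one, id]; ring
    · obtain ⟨u, hu, j, hj⟩ := hStau (m + 1)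
      refine ⟨u, hu, j, ?_⟩
      rw [hj, tau_succ hN hd]; push_cast; ring
  have hL2 : (2 : ℝ) ≤ L := by
    have : (1 : ℝ) ≤ N := by exact_mod_cast hN
    linarith
  have hiso : IsIsolatedCO c := by
    refine isolated_of c hc S hS1 ?_
    intro s w hred
    obtain ⟨m, hm, h1, h2⟩ := ping w s hred
    obtain ⟨u, hu, ju, hju⟩ := hStau m
    obtain ⟨v, hv, jv, hjv⟩ := hSe m
    have out : ∀ g (i : ℤ), (tau N m : ℝ) + 1 ≤ ρ g (-1) + i * L →
        ρ g (-1) + i * L < tau N m + L → Out c u v g := by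
      intro g i hi1 hi2
      rcases hi1.eq_or_lt with hi | hi
      · left
        exact inj _ _ ⟨i + jv, by rw [hjv, hi]; push_cast; ring⟩
      · right
        simp only [c]
        rw [hju, hjv, ori_swap, ← ori_shift hL _ _ _ 0 0 i]
        have := ori_shift hL (tau N m) (tau N m + 1) (ρ g (-1) + i * L) ju jv 0
        simp only [Int.cast_zero, zero_mul, add_zero] at this ⊢
        rw [this, ori_eq_one hL (by linarith) hi (by linarith)]
    refine ⟨u, hu, v, hv, ?_, ?_, ?_, ?_, ?_⟩
    · obtain ⟨u', hu', j', hj'⟩ := hSe (m - D)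
      have : mk [s] * u' = u := by
        apply inj
        refine ⟨ju - j', ?_⟩
        rw [_root_.map_mul, RelIso.mul_apply, hj', hρL, (hρ2 s m hm).1, hju]
        push_cast; ring
      rw [← this, inv_mul_cancel_left]; exact hu'
    · obtain ⟨u', hu', j', hj'⟩ := hStau (m + D)
      have : mk [s] * u' = v := by
        apply inj
        refine ⟨jv - j', ?_⟩
        rw [_root_.map_mul, RelIso.mul_apply, hj', hρL, (hρ2 s m hm).2, hjv]
        push_cast; ring
      rw [← this, inv_mul_cancel_left]; exact hu'
    · rcases h1.eq_or_lt with h | h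
      · left
        exact inj _ _ ⟨ju, by rw [hju, h]⟩
      · right
        simp only [c]
        rw [hju, hjv]
        have := ori_shift hL (tau N m) (ρ (mk (s :: w)) (-1)) (tau N m + 1) ju 0 jv
        simp only [Int.cast_zero, zero_mul, add_zero] at this
        rw [this, ori_eq_one hL h h2 (by linarith)]
    · intro x hx
      obtain ⟨z, hz⟩ := hSint x hx
      obtain ⟨i, hi1, hi2⟩ := exists_rep hL (tau N m) (ρ x (-1))
      by_cases h : (tau N m : ℝ) = ρ x (-1) + i * L
      · left
        exact inj _ _ ⟨i + ju, by rw [hju, h]; push_cast; ring⟩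
      · right
        refine out x i ?_ hi2
        have h3 := lt_of_le_of_ne hi1 h
        rw [hz, hLe] at h3 ⊢
        have h4 : tau N m < z + i * (N + 1) := by exact_mod_cast h3
        exact_mod_cast h4
    · intro s' w' hred' hne
      obtain ⟨m', hm', g1, g2⟩ := ping w' s' hred'
      obtain ⟨i, hi1, hi2⟩ := exists_rep hL (tau N m) (ρ (mk (s' :: w')) (-1))
      refine out _ i ?_ hi2
      by_contra hlt
      have e := tauL m' i
      have := tau_inj' hN (a := m' + i * N) (b := m) (x := ρ (mk (s' :: w')) (-1) + i * L)
        (by linarith) (by linarith) hi1 (not_le.1 hlt)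
      apply hne
      apply label_ne
      have h5 := dvd_add (dvd_sub hm hm') (Dvd.dvd.mul_left hDN (-i))
      have e6 : label D s' - label D s = m - label D s - (m' - label D s') + -i * N := by
        rw [← this]; ring
      rw [e6]; exact h5
  refine ⟨c, hc, hiso, ?_⟩
  intro x hx1 hxT
  obtain ⟨r, hr⟩ : ∃ r, Nn = r + 1 := ⟨Nn - 1, by omega⟩
  have hTN : ρ (mk (Tl D hD Nn)) (-1) = 0 + ((D - 1 : ℤ) : ℝ) * L := by
    have := PT r (by omega)
    rw [← hr] at this
    rw [this, show ((r : ℤ) + 1) * (D - 1) = (D - 1) * N by rw [hNN, hr]; push_cast; ring,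
      tau_mul hN, hLe]
    push_cast; ring
  obtain ⟨i, hi1, hi2⟩ := exists_rep hL (-1) (ρ x (-1))
  have hpos : 0 < ρ x (-1) + i * L := by
    by_contra hc0
    have hc0 := not_lt.1 hc0
    rcases hc0.eq_or_lt with h | h
    · apply hxT
      apply inj
      exact ⟨i + (D - 1), by rw [hTN]; push_cast; linear_combination -h⟩
    rcases hi1.eq_or_lt with h' | h'
    · exact hx1 (free x (-i) (by push_cast; linarith))
    rw [← mk_toWord (x := x)] at hx1 h h'
    have hr := isReduced_toWord (x := x)
    cases hw : x.toWord with
    | nil => rw [hw] at hx1; exact hx1 rfl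
    | cons s w =>
      rw [hw] at h h' hr
      obtain ⟨m, -, h1, h2⟩ := ping w s hr
      have e := tauL m i
      apply tau_ne hN (m + i * N) 0
      have a1 : (tau N (m + i * N) : ℝ) < 0 := by linarith
      have a2 : (-1 : ℝ) < tau N (m + i * N) + 1 := by linarith
      have a1' : tau N (m + i * N) < 0 := by exact_mod_cast a1
      have a2' : -1 < tau N (m + i * N) + 1 := by exact_mod_cast a2
      omega
  simp only [c]
  rw [hTN, _root_.map_one, ← ori_shift hL _ _ _ 0 0 i]
  have := ori_shift hL (-1) 0 (ρ x (-1) + i * L) 0 (D - 1) 0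
  simp only [Int.cast_zero, zero_mul, add_zero, RelIso.coe_one, id] at this ⊢
  rw [this, ori_eq_one hL (by norm_num) hpos hi2]

end FGCO
noncomputable section

/-- **Isolated circular orders on free groups of even rank.**  For every `n ≥ 1`, the set of
isolated points of `CO(F_{2n})` is infinite, and there is an infinite family of isolated
circular orders on `F_{2n}` which are pairwise non-conjugate under the conjugation action
`c_g(x,y,z) = c(xg, yg, zg)`. -/
theorem free_group_infinitely_many_isolated_circular_orders (n : ℕ) (hn : 1 ≤ n) :
    {c : FreeGroup (Fin (2 * n)) → FreeGroup (Fin (2 * n)) → FreeGroup (Fin (2 * n)) → ℤ |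
        IsCircularOrder c ∧ IsIsolatedCO c}.Infinite ∧
    ∃ T : Set (FreeGroup (Fin (2 * n)) → FreeGroup (Fin (2 * n)) → FreeGroup (Fin (2 * n)) → ℤ),
      T.Infinite ∧
      (∀ c ∈ T, IsCircularOrder c ∧ IsIsolatedCO c) ∧
      (∀ c ∈ T, ∀ c' ∈ T, c ≠ c' →
        ∀ g : FreeGroup (Fin (2 * n)),
          c' ≠ fun x y z => c (x * g) (y * g) (z * g)) := by
  have hD : 2 ≤ 2 * n := by omega
  have cop : ∀ q : ℕ, Nat.Coprime (2 * n - 1) (2 * (2 * n) * ((2 * n - 1) * q + 1)) := by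
    intro q
    obtain ⟨m, rfl⟩ : ∃ m, n = m + 1 := ⟨n - 1, by omega⟩
    have e : 2 * (m + 1) - 1 = 2 * m + 1 := by omega
    rw [e]
    refine Nat.Coprime.mul_right (Nat.Coprime.mul_right ?_ ?_) ?_
    · simp
    · have : 2 * (m + 1) = (2 * m + 1) + 1 := by ring
      rw [this]; simp
    · simp
  choose c hc hiso hsucc using fun q : ℕ =>
    FGCO.main_k (2 * n) ((2 * n - 1) * q + 1) hD (by omega) (cop q)
  have claim : ∀ q q' g, c q' = (fun x y z => c q (x * g) (y * g) (z * g)) → q = q' := by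
    intro q q' g h
    set M := 2 * (2 * n) * ((2 * n - 1) * q + 1) with hM
    set M' := 2 * (2 * n) * ((2 * n - 1) * q' + 1) with hM'
    set t := FreeGroup.mk (FGCO.Tl (2 * n) hD M) with ht
    set t' := FreeGroup.mk (FGCO.Tl (2 * n) hD M') with ht'
    have hs := hsucc q
    have hs' := hsucc q'
    have t1 : t ≠ 1 := by
      intro h1
      have := FGCO.norm_T (2 * n) hD M
      rw [← ht, h1, FreeGroup.norm_one] at this
      have : 0 < M := by positivity
      omega
    have t1' : t' ≠ 1 := by
      intro h1
      have := FGCO.norm_T (2 * n) hD M'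
      rw [← ht', h1, FreeGroup.norm_one] at this
      have : 0 < M' := by positivity
      omega
    have key : t = g⁻¹ * t' * g := by
      by_contra hne
      have a1 := hs' (g * t * g⁻¹) (by
        intro h1; apply t1
        have : t = g⁻¹ * (g * t * g⁻¹) * g := by group
        rw [this, h1]; group) (by
        intro h1; apply hne
        rw [← ht'] at h1
        rw [← h1]; group)
      rw [h] at a1
      have a2 := (hc q).2.2.2 g⁻¹ (1 * g) (t' * g) (g * t * g⁻¹ * g)
      have a3 : c q 1 (g⁻¹ * t' * g) t = 1 := by
        have b1 : g⁻¹ * (1 * g) = 1 := by group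
        have b2 : g⁻¹ * (t' * g) = g⁻¹ * t' * g := by group
        have b3 : g⁻¹ * (g * t * g⁻¹ * g) = t := by group
        rw [b1, b2, b3] at a2
        rw [a2]; exact a1
      have a4 : c q 1 t (g⁻¹ * t' * g) = 1 := hs _ (by
        intro h1; apply t1'
        have : t' = g * (g⁻¹ * t' * g) * g⁻¹ := by group
        rw [this, h1]; group) (fun h1 => hne h1.symm)
      have := FGCO.co_swap (hc q) 1 t (g⁻¹ * t' * g)
      omega
    have key' : t' = (g⁻¹)⁻¹ * t * g⁻¹ := by rw [key]; group
    have l1 : M ≤ M' := FGCO.T_conj (2 * n) hD M M' ⟨_, rfl⟩ ⟨_, rfl⟩ g key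
    have l2 : M' ≤ M := FGCO.T_conj (2 * n) hD M' M ⟨_, rfl⟩ ⟨_, rfl⟩ g⁻¹ key'
    have e := le_antisymm l1 l2
    have e2 := Nat.eq_of_mul_eq_mul_left (by positivity) e
    have e3 : (2 * n - 1) * q = (2 * n - 1) * q' := by omega
    exact Nat.eq_of_mul_eq_mul_left (by omega) e3
  have inj : Function.Injective c := by
    intro q q' h
    exact claim q q' 1 (by rw [← h]; simp)
  have inf := Set.infinite_range_of_injective inj
  refine ⟨inf.mono ?_, Set.range c, inf, ?_, ?_⟩
  · rintro _ ⟨q, rfl⟩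
    exact ⟨hc q, hiso q⟩
  · rintro _ ⟨q, rfl⟩
    exact ⟨hc q, hiso q⟩
  · rintro _ ⟨q, rfl⟩ _ ⟨q', rfl⟩ hne g h
    exact hne (by rw [claim q q' g h])

end
end
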